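/- arXiv:2605.06034 — 2 statements merged into one kernel-verified Lean document; each statement's English description precedes it below -/
import Mathlib

section
/- The series ∑_{k=1}^∞ H_k^{(2)}·h_k²/k² converges and equals (45/8)·ζ(6) - (7/4)·ζ(3)² + (3/4)·∑_{k=1}^∞ h_k/k⁵. -/
open Finset Real

noncomputable def H (k : ℕ) : ℝ := ∑ j ∈ Finset.range k, (1 : ℝ) / ((j : ℝ) + 1)
noncomputable def H2 (k : ℕ) : ℝ := ∑ j ∈ Finset.range k, (1 : ℝ) / ((j : ℝ) + 1) ^ 2
noncomputable def H3 (k : ℕ) : ℝ := ∑ j ∈ Finset.range k, (1 : ℝ) / ((j : ℝ) + 1) ^ 3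
noncomputable def h (k : ℕ) : ℝ := ∑ j ∈ Finset.range k, (1 : ℝ) / (2 * (j : ℝ) + 1)
noncomputable def h2 (k : ℕ) : ℝ := ∑ j ∈ Finset.range k, (1 : ℝ) / (2 * (j : ℝ) + 1) ^ 2
noncomputable def h3 (k : ℕ) : ℝ := ∑ j ∈ Finset.range k, (1 : ℝ) / (2 * (j : ℝ) + 1) ^ 3
noncomputable def zeta (s : ℕ) : ℝ := ∑' n : ℕ, (1 : ℝ) / ((n : ℝ) + 1) ^ s

namespace DoubleShuffle

/-- Letters of iterated-integral words: `none` is `dt/t`, `some true` is `dt/(1-t²)` and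
`some false` is `t dt/(1-t²)`. The outermost form comes first. -/
abbrev Word := List (Option Bool)

/-- Indices of nested sums `∑ n₁^{-(k₁+1)} n₂^{-(k₂+1)} ⋯` over `n₁ > n₂ > ⋯ > 0`; the boolean
records whether the summation variable is odd. -/
abbrev Index := List (ℕ × Bool)

def shuffleAux (x : Option Bool) (u : Word) (su : Word → List Word) : Word → List Word
  | [] => [x :: u]
  | y :: v => (su (y :: v)).map (x :: ·) ++ (shuffleAux x u su v).map (y :: ·)

/-- The words whose sum is the shuffle product of two words. -/
def shuffle : Word → Word → List Word
  | [] => fun v => [v]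
  | x :: u => shuffleAux x u (shuffle u)

def stuffleAux (x : ℕ × Bool) (u : Index) (su : Index → List Index) : Index → List Index
  | [] => [x :: u]
  | y :: v => (su (y :: v)).map (x :: ·) ++ (stuffleAux x u su v).map (y :: ·) ++
      bif x.2 == y.2 then (su v).map ((x.1 + y.1 + 1, x.2) :: ·) else []

/-- The indices in the expansion of a product of two nested sums. -/
def stuffle : Index → Index → List Index
  | [] => fun v => [v]
  | x :: u => stuffleAux x u (stuffle u)

/-- The parity of the outermost summation variable. -/
def parity : Index → Bool
  | [] => false
  | (_, p) :: _ => p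

/-- The word whose iterated integral is the nested sum with the given index. -/
def word : Index → Word
  | [] => []
  | (k, p) :: m => List.replicate k none ++ some (p ^^ parity m) :: word m

theorem shuffle_nil_right (u : Word) : shuffle u [] = [u] := by cases u <;> rfl

theorem shuffle_cons_cons (x y : Option Bool) (u v : Word) :
    shuffle (x :: u) (y :: v) =
      (shuffle u (y :: v)).map (x :: ·) ++ (shuffle (x :: u) v).map (y :: ·) := rfl

theorem stuffle_nil_right (u : Index) : stuffle u [] = [u] := by cases u <;> rfl

theorem stuffle_cons_cons (x y : ℕ × Bool) (u v : Index) :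
    stuffle (x :: u) (y :: v) =
      (stuffle u (y :: v)).map (x :: ·) ++ (stuffle (x :: u) v).map (y :: ·) ++
        bif x.2 == y.2 then (stuffle u v).map ((x.1 + y.1 + 1, x.2) :: ·) else [] := rfl

theorem nil_notMem_shuffle_cons_right (u : Word) (y : Option Bool) (v : Word) :
    [] ∉ shuffle u (y :: v) := by
  cases u with
  | nil => simp [shuffle]
  | cons x u => simp [shuffle_cons_cons]

theorem nil_notMem_shuffle_cons_left (x : Option Bool) (u v : Word) :
    [] ∉ shuffle (x :: u) v := by
  cases v with
  | nil => simp [shuffle_nil_right]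
  | cons y v => simp [shuffle_cons_cons]

/-! ### Nested sums -/

/-- The part of the nested sum where the outermost summation variable equals `n`. -/
noncomputable def term : Index → ℕ → ℝ
  | [], n => if n = 0 then 1 else 0
  | (k, p) :: m, n =>
    if n.bodd = p then (∑ j ∈ Finset.range n, term m j) / (n : ℝ) ^ (k + 1) else 0

/-- The nested sum with all summation variables below `N`. -/
noncomputable def trunc (m : Index) (N : ℕ) : ℝ := ∑ n ∈ Finset.range N, term m n

theorem term_nil (n : ℕ) : term [] n = if n = 0 then 1 else 0 := by rw [term]

theorem term_cons (k : ℕ) (p : Bool) (m : Index) (n : ℕ) :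
    term ((k, p) :: m) n = if n.bodd = p then trunc m n / (n : ℝ) ^ (k + 1) else 0 := by
  rw [term, trunc]

theorem trunc_zero (m : Index) : trunc m 0 = 0 := by simp [trunc]

theorem trunc_succ (m : Index) (N : ℕ) : trunc m (N + 1) = trunc m N + term m N := by
  simp [trunc, Finset.sum_range_succ]

theorem trunc_nil_succ (N : ℕ) : trunc [] (N + 1) = 1 := by
  induction N with
  | zero => simp [trunc_succ, trunc_zero, term_nil]
  | succ N ih => rw [trunc_succ, ih]; simp [term_nil]

theorem term_nonneg (m : Index) (n : ℕ) : 0 ≤ term m n := by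
  induction m generalizing n with
  | nil => rw [term_nil]; positivity
  | cons x m ih =>
    obtain ⟨k, p⟩ := x
    rw [term_cons]
    have : 0 ≤ trunc m n := Finset.sum_nonneg fun j _ => ih j
    positivity

theorem term_eq_zero_of_bodd_ne {m : Index} {n : ℕ} (hn : n.bodd ≠ parity m) : term m n = 0 := by
  cases m with
  | nil =>
    rw [term_nil, if_neg]
    rintro rfl
    exact hn rfl
  | cons x m => obtain ⟨k, p⟩ := x; exact (term_cons k p m n).trans (if_neg hn)

theorem sum_map_term_cons (k : ℕ) (p : Bool) (L : List Index) (n : ℕ) :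
    ((L.map ((k, p) :: ·)).map (term · n)).sum =
      if n.bodd = p then (L.map (trunc · n)).sum / (n : ℝ) ^ (k + 1) else 0 := by
  induction L with
  | nil => simp
  | cons m L ih =>
    simp only [List.map_cons, List.sum_cons, ih, term_cons]
    split_ifs <;> ring

theorem sum_map_trunc_succ (L : List Index) (N : ℕ) :
    (L.map (trunc · (N + 1))).sum = (L.map (trunc · N)).sum + (L.map (term · N)).sum := by
  induction L with
  | nil => simp
  | cons m L ih => simp only [List.map_cons, List.sum_cons]; rw [ih, trunc_succ]; ring

theorem trunc_mul_trunc (u v : Index) (N : ℕ) :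
    trunc u N * trunc v N = ((stuffle u v).map (trunc · N)).sum := by
  induction N generalizing u v with
  | zero =>
    simp [trunc_zero]
  | succ N ih =>
    match u, v with
    | [], v => simp [stuffle, trunc_nil_succ]
    | u, [] => simp [stuffle_nil_right, trunc_nil_succ]
    | (k, p) :: u, (l, q) :: v =>
      rw [sum_map_trunc_succ, ← ih, trunc_succ, trunc_succ, stuffle_cons_cons]
      simp only [List.map_append, List.sum_append]
      rw [sum_map_term_cons, sum_map_term_cons, ← ih, ← ih, term_cons, term_cons]
      cases hpq : p == q with
      | false =>
        have : p ≠ q := by simpa using hpq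
        simp only [cond_false, List.map_nil, List.sum_nil]
        split_ifs with h1 h2 h2
        · exact absurd (h1.symm.trans h2) this
        all_goals ring
      | true =>
        obtain rfl : p = q := by simpa using hpq
        simp only [cond_true]
        rw [sum_map_term_cons, ← ih]
        split_ifs
        · ring
        · ring

/-! ### Words as power series -/

/-- The coefficients of `t • ω` for the one-form `ω dt` attached to a letter. -/
noncomputable def form : Option Bool → PowerSeries ℝ
  | none => 1
  | some b => PowerSeries.mk fun n => if n ≠ 0 ∧ n.bodd = b then 1 else 0

/-- The iterated integral from `0` to `t` attached to a word, as a power series in `t`. -/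
noncomputable def series : Word → PowerSeries ℝ
  | [] => 1
  | x :: u => PowerSeries.mk fun n => PowerSeries.coeff n (form x * series u) / n

/-- The Euler operator `t d/dt` on power series. -/
noncomputable def euler (f : PowerSeries ℝ) : PowerSeries ℝ :=
  PowerSeries.mk fun n => n * PowerSeries.coeff n f

theorem euler_mul (f g : PowerSeries ℝ) : euler (f * g) = euler f * g + f * euler g := by
  ext n
  simp only [euler, PowerSeries.coeff_mk, map_add, PowerSeries.coeff_mul, Finset.mul_sum,
    ← Finset.sum_add_distrib]
  refine Finset.sum_congr rfl fun x hx => ?_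
  rw [← Finset.HasAntidiagonal.mem_antidiagonal.mp hx]
  push_cast
  ring

theorem euler_add (f g : PowerSeries ℝ) : euler (f + g) = euler f + euler g := by
  ext n
  simp [euler, mul_add]

theorem eq_of_euler_eq {f g : PowerSeries ℝ} (h : euler f = euler g)
    (h0 : PowerSeries.constantCoeff f = PowerSeries.constantCoeff g) : f = g := by
  ext n
  rcases n.eq_zero_or_pos with rfl | hn
  · simpa using h0
  · have := congrArg (PowerSeries.coeff n) h
    simp only [euler, PowerSeries.coeff_mk] at this
    exact mul_left_cancel₀ (by positivity) this

theorem constantCoeff_series_cons (x : Option Bool) (u : Word) :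
    PowerSeries.constantCoeff (series (x :: u)) = 0 := by
  rw [← PowerSeries.coeff_zero_eq_constantCoeff_apply]
  simp [series]

theorem euler_series_cons {x : Option Bool} {u : Word} (hx : x ≠ none ∨ u ≠ []) :
    euler (series (x :: u)) = form x * series u := by
  ext n
  simp only [euler, series, PowerSeries.coeff_mk]
  rcases n.eq_zero_or_pos with rfl | hn
  · cases x with
    | none =>
      cases u with
      | nil => simp at hx
      | cons y u => simp [constantCoeff_series_cons]
    | some b => simp [form, PowerSeries.coeff_mul]
  · field_simp

/-- Words whose innermost form is integrable at `0`. -/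
def Good : Word → Prop
  | [] => True
  | x :: u => (x ≠ none ∨ u ≠ []) ∧ Good u

theorem euler_sum_series_cons (x : Option Bool) (L : List Word) (hL : [] ∉ L) :
    euler ((L.map (x :: ·)).map series).sum = form x * (L.map series).sum := by
  induction L with
  | nil => ext n; simp [euler]
  | cons u L ih =>
    simp only [List.mem_cons, not_or] at hL
    simp only [List.map_cons, List.sum_cons, euler_add, ih hL.2]
    rw [euler_series_cons (Or.inr (Ne.symm hL.1))]
    ring

theorem constantCoeff_sum_series_cons (x : Option Bool) (L : List Word) :
    PowerSeries.constantCoeff ((L.map (x :: ·)).map series).sum = 0 := by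
  induction L with
  | nil => simp
  | cons u L ih =>
    simp only [List.map_cons, List.sum_cons, map_add, ih, constantCoeff_series_cons, add_zero]

theorem series_mul_series : ∀ {u v : Word}, Good u → Good v →
    series u * series v = ((shuffle u v).map series).sum
  | [], v, _, _ => by simp [shuffle, series]
  | x :: u, [], _, _ => by simp [shuffle_nil_right, series]
  | x :: u, y :: v, hu, hv => by
    have h1 := series_mul_series hu.2 hv
    have h2 := series_mul_series hu hv.2
    rw [shuffle_cons_cons, List.map_append, List.sum_append]
    apply eq_of_euler_eq
    · rw [euler_mul, euler_add, euler_series_cons hu.1, euler_series_cons hv.1,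
        euler_sum_series_cons x _ (nil_notMem_shuffle_cons_right u y v),
        euler_sum_series_cons y _ (nil_notMem_shuffle_cons_left x u v), ← h1, ← h2]
      ring
    · rw [map_mul, map_add, constantCoeff_sum_series_cons, constantCoeff_sum_series_cons,
        constantCoeff_series_cons]
      simp
termination_by u v => u.length + v.length

theorem good_word (m : Index) : Good (word m) := by
  induction m with
  | nil => trivial
  | cons x m ih =>
    obtain ⟨k, p⟩ := x
    rw [word]
    induction k with
    | zero => exact ⟨by simp, ih⟩
    | succ k hk => exact ⟨by simp, hk⟩

theorem coeff_series_word (m : Index) (n : ℕ) :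
    PowerSeries.coeff n (series (word m)) = term m n := by
  induction m generalizing n with
  | nil => simp [word, series, term_nil, PowerSeries.coeff_one]
  | cons x m ih =>
    obtain ⟨k, p⟩ := x
    rw [word]
    induction k generalizing n with
    | zero =>
      simp only [List.replicate_zero, List.nil_append, series, PowerSeries.coeff_mk, form,
        PowerSeries.coeff_mul, ih, term_cons, zero_add, pow_one]
      rw [← Finset.Nat.sum_antidiagonal_swap,
        Finset.Nat.sum_antidiagonal_eq_sum_range_succ_mk, Finset.sum_range_succ]
      have hterm : ∀ j ∈ Finset.range n,
          (if n - j ≠ 0 ∧ (n - j).bodd = (p ^^ parity m) then (1 : ℝ) else 0) * term m j =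
            if n.bodd = p then term m j else 0 := by
        intro j hj
        have hjn := Finset.mem_range.mp hj
        by_cases hpar : j.bodd = parity m
        · have hb : n.bodd = ((n - j).bodd ^^ parity m) := by
            rw [← hpar, ← Nat.bodd_add, Nat.sub_add_cancel hjn.le]
          have : n - j ≠ 0 := by omega
          rw [hb]
          cases (n - j).bodd <;> cases parity m <;> cases p <;> simp [this]
        · simp [term_eq_zero_of_bodd_ne hpar]
      simp only [Prod.swap_prod_mk]
      rw [Finset.sum_congr rfl hterm, trunc, if_neg (by simp)]
      split_ifs <;> simp
    | succ k hk =>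
      rw [List.replicate_succ, List.cons_append, series]
      simp only [PowerSeries.coeff_mk, form, one_mul, hk, term_cons]
      split_ifs
      · rw [div_div, pow_succ _ (k + 1)]
      · simp

theorem coeff_form_nonneg (x : Option Bool) (n : ℕ) : 0 ≤ PowerSeries.coeff n (form x) := by
  cases x with
  | none => rw [form, PowerSeries.coeff_one]; positivity
  | some b => rw [form, PowerSeries.coeff_mk]; positivity

theorem coeff_form_le_one (x : Option Bool) (n : ℕ) : PowerSeries.coeff n (form x) ≤ 1 := by
  cases x with
  | none => rw [form, PowerSeries.coeff_one]; split_ifs <;> norm_num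
  | some b => rw [form, PowerSeries.coeff_mk]; split_ifs <;> norm_num

theorem coeff_series_nonneg (u : Word) (n : ℕ) : 0 ≤ PowerSeries.coeff n (series u) := by
  induction u generalizing n with
  | nil => rw [series, PowerSeries.coeff_one]; positivity
  | cons x u ih =>
    rw [series, PowerSeries.coeff_mk, PowerSeries.coeff_mul]
    exact div_nonneg (Finset.sum_nonneg fun p _ => mul_nonneg (coeff_form_nonneg x _) (ih _))
      n.cast_nonneg

theorem coeff_series_cons_le (x : Option Bool) (u : Word) (n : ℕ) :
    PowerSeries.coeff n (series (x :: u)) ≤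
      (∑ j ∈ Finset.range (n + 1), PowerSeries.coeff j (series u)) / n := by
  rw [series, PowerSeries.coeff_mk, PowerSeries.coeff_mul, ← Finset.Nat.sum_antidiagonal_swap,
    Finset.Nat.sum_antidiagonal_eq_sum_range_succ_mk]
  refine div_le_div_of_nonneg_right (Finset.sum_le_sum fun j _ => ?_) n.cast_nonneg
  exact mul_le_of_le_one_left (coeff_series_nonneg u j) (coeff_form_le_one x _)

theorem sqrt_succ_le {n : ℕ} (hn : 1 ≤ n) : √((n : ℝ) + 1) ≤ 2 * √n := by
  have h1 : (1 : ℝ) ≤ n := by exact_mod_cast hn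
  rw [Real.sqrt_le_left (by positivity), mul_pow, Real.sq_sqrt (by positivity)]
  linarith

theorem exists_sum_coeff_series_le (u : Word) :
    ∃ C : ℝ, 0 ≤ C ∧ ∀ N : ℕ,
      ∑ j ∈ Finset.range N, PowerSeries.coeff j (series u) ≤ C * √N := by
  induction u with
  | nil =>
    refine ⟨1, zero_le_one, fun N => ?_⟩
    cases N with
    | zero => simp
    | succ N =>
      simp only [series, PowerSeries.coeff_one, Finset.sum_ite_eq', Finset.mem_range,
        Nat.succ_pos, if_true, one_mul]
      rw [Real.one_le_sqrt]
      push_cast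
      linarith [N.cast_nonneg (α := ℝ)]
  | cons x u ih =>
    obtain ⟨C, hC, hu⟩ := ih
    refine ⟨6 * C, by positivity, fun N => ?_⟩
    induction N with
    | zero => simp
    | succ N hN =>
      rw [Finset.sum_range_succ]
      rcases N.eq_zero_or_pos with rfl | hpos
      · have : PowerSeries.coeff 0 (series (x :: u)) = 0 := by simp [series]
        rw [this]
        simp only [Finset.range_zero, Finset.sum_empty, add_zero]
        positivity
      · have hNpos : (0 : ℝ) < N := by exact_mod_cast hpos
        have hs := sqrt_succ_le hpos
        have hsq : 0 < √(N : ℝ) := Real.sqrt_pos.mpr hNpos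
        have hcoeff : PowerSeries.coeff N (series (x :: u)) ≤ 2 * C / √N := by
          refine (coeff_series_cons_le x u N).trans ?_
          rw [div_le_div_iff₀ hNpos hsq]
          have h1 := hu (N + 1)
          push_cast at h1
          have h2 : ∑ j ∈ Finset.range (N + 1), PowerSeries.coeff j (series u) ≤ 2 * C * √N :=
            h1.trans (by nlinarith)
          calc _ ≤ 2 * C * √N * √N := by gcongr
            _ = 2 * C * N := by rw [mul_assoc, Real.mul_self_sqrt hNpos.le]
        have hstep : 2 * C / √N ≤ 6 * C * (√((N : ℝ) + 1) - √N) := by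
          rw [div_le_iff₀ hsq]
          have h1 : (√((N : ℝ) + 1) - √N) * (√((N : ℝ) + 1) + √N) = 1 := by
            have := Real.mul_self_sqrt hNpos.le
            have := Real.mul_self_sqrt (show (0 : ℝ) ≤ N + 1 by positivity)
            nlinarith
          have h2 : 0 ≤ √((N : ℝ) + 1) - √N := sub_nonneg.mpr (Real.sqrt_le_sqrt (by linarith))
          have h3 : 1 ≤ 3 * ((√((N : ℝ) + 1) - √N) * √N) := by nlinarith
          nlinarith
        push_cast
        linarith

theorem summable_series_none_cons (u : Word) :
    Summable fun n => PowerSeries.coeff n (series (none :: u)) := by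
  have heq : ∀ n, PowerSeries.coeff n (series (none :: u)) =
      PowerSeries.coeff n (series u) / n := fun n => by
    rw [series, PowerSeries.coeff_mk, form, one_mul]
  cases u with
  | nil =>
    refine summable_zero.congr fun n => ?_
    rw [heq, series, PowerSeries.coeff_one]
    split_ifs with hn <;> simp [hn]
  | cons x u =>
    obtain ⟨C, hC, hu⟩ := exists_sum_coeff_series_le u
    have hs : Summable fun n : ℕ => 2 * C * (1 / (n : ℝ) ^ (3 / 2 : ℝ)) :=
      (Real.summable_one_div_nat_rpow.mpr (by norm_num)).mul_left _
    refine Summable.of_nonneg_of_le (fun n => coeff_series_nonneg _ n) (fun n => ?_) hs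
    rcases n.eq_zero_or_pos with rfl | hn
    · rw [heq]
      simp only [CharP.cast_eq_zero, div_zero]
      positivity
    · have hpos : (0 : ℝ) < n := by exact_mod_cast hn
      have h1 := hu (n + 1)
      push_cast at h1
      have h2 : ∑ j ∈ Finset.range (n + 1), PowerSeries.coeff j (series u) ≤ 2 * C * √n :=
        h1.trans (by nlinarith [sqrt_succ_le hn])
      rw [heq]
      calc _ ≤ (2 * C * √n) / n / n := by
            gcongr
            exact (coeff_series_cons_le x u n).trans (by gcongr)
        _ = 2 * C * (1 / (n : ℝ) ^ (3 / 2 : ℝ)) := by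
            rw [show (3 / 2 : ℝ) = 2 - 1 / 2 by norm_num, Real.rpow_sub hpos, Real.rpow_two,
              ← Real.sqrt_eq_rpow]
            field_simp

/-! ### Values at one and double shuffle relations -/

/-- The iterated integral from `0` to `1` attached to a word starting with `none`. -/
noncomputable def val (u : Word) : ℝ := ∑' n, PowerSeries.coeff n (series u)

/-- Words whose outermost form is integrable at `1`. -/
def Convergent (u : Word) : Prop := u = [] ∨ ∃ v, u = none :: v

theorem Convergent.summable {u : Word} (hu : Convergent u) :
    Summable fun n => PowerSeries.coeff n (series u) := by
  obtain rfl | ⟨v, rfl⟩ := hu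
  · refine (hasSum_ite_eq 0 (1 : ℝ)).summable.congr fun n => ?_
    rw [series, PowerSeries.coeff_one]
  · exact summable_series_none_cons v

theorem Convergent.hasSum {u : Word} (hu : Convergent u) :
    HasSum (fun n => PowerSeries.coeff n (series u)) (val u) := hu.summable.hasSum

theorem hasSum_coeff_sum_series (L : List Word) (hL : ∀ u ∈ L, Convergent u) :
    HasSum (fun n => PowerSeries.coeff n (L.map series).sum) (L.map val).sum := by
  induction L with
  | nil => simp [hasSum_zero]
  | cons u L ih =>
    simp only [List.map_cons, List.sum_cons, map_add]
    exact (hL u (by simp)).hasSum.add (ih fun v hv => hL v (by simp [hv]))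

theorem Convergent.shuffle {u v : Word} (hu : Convergent u) (hv : Convergent v) :
    ∀ w ∈ shuffle u v, Convergent w := by
  obtain rfl | ⟨u, rfl⟩ := hu
  · simp [DoubleShuffle.shuffle, hv]
  · obtain rfl | ⟨v, rfl⟩ := hv
    · simp [shuffle_nil_right, Convergent]
    · rw [shuffle_cons_cons]
      simp only [List.mem_append, List.mem_map]
      rintro w (⟨a, -, rfl⟩ | ⟨a, -, rfl⟩) <;> exact Or.inr ⟨_, rfl⟩

theorem val_mul_val_eq_shuffle {u v : Word} (hu : Convergent u) (hv : Convergent v)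
    (gu : Good u) (gv : Good v) : val u * val v = ((shuffle u v).map val).sum := by
  rw [val, val, tsum_mul_tsum_eq_tsum_sum_antidiagonal_of_summable_norm hu.summable.norm
    hv.summable.norm]
  simp only [← PowerSeries.coeff_mul, series_mul_series gu gv]
  exact (hasSum_coeff_sum_series _ (hu.shuffle hv)).tsum_eq

/-- Indices of convergent nested sums. -/
def admissible : Index → Bool
  | [] => true
  | (k, _) :: _ => k != 0

theorem convergent_word {m : Index} (hm : admissible m = true) : Convergent (word m) := by
  match m, hm with
  | [], _ => exact Or.inl rfl
  | (k + 1, p) :: m, _ => exact Or.inr ⟨_, rfl⟩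

theorem hasSum_term {m : Index} (hm : admissible m = true) : HasSum (term m) (val (word m)) := by
  have := (convergent_word hm).hasSum
  simpa only [coeff_series_word] using this

theorem hasSum_sum_term (L : List Index) (hL : ∀ m ∈ L, admissible m = true) :
    HasSum (fun n => (L.map (term · n)).sum) (L.map (val <| word ·)).sum := by
  induction L with
  | nil => simp [hasSum_zero]
  | cons u L ih =>
    simp only [List.map_cons, List.sum_cons]
    exact (hasSum_term (hL u (by simp))).add (ih fun v hv => hL v (by simp [hv]))

theorem admissible_stuffle {u v : Index} (hu : admissible u = true) (hv : admissible v = true) :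
    ∀ m ∈ stuffle u v, admissible m = true := by
  match u, v with
  | [], v => simp [stuffle, hv]
  | x :: u, [] => simp [stuffle_nil_right, hu]
  | (k, p) :: u, (l, q) :: v =>
    simp only [admissible, bne_iff_ne, ne_eq] at hu hv
    rw [stuffle_cons_cons]
    intro m hm
    cases hpq : p == q <;>
    simp only [hpq, cond_true, cond_false, List.mem_append, List.mem_map, List.not_mem_nil,
      or_false] at hm
    · rcases hm with ⟨a, -, rfl⟩ | ⟨a, -, rfl⟩ <;> simp [admissible, hu, hv]
    · rcases hm with (⟨a, -, rfl⟩ | ⟨a, -, rfl⟩) | ⟨a, -, rfl⟩ <;> simp [admissible, hu, hv]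

theorem sum_map_trunc_eq_sum_range (L : List Index) (N : ℕ) :
    (L.map (trunc · N)).sum = ∑ n ∈ Finset.range N, (L.map (term · n)).sum := by
  induction N with
  | zero => simp [trunc_zero]
  | succ N ih => rw [sum_map_trunc_succ, ih, Finset.sum_range_succ]

theorem val_mul_val_eq_stuffle {u v : Index} (hu : admissible u = true)
    (hv : admissible v = true) :
    val (word u) * val (word v) = ((stuffle u v).map (val <| word ·)).sum := by
  have h1 := (hasSum_term hu).tendsto_sum_nat.mul (hasSum_term hv).tendsto_sum_nat
  have h2 := (hasSum_sum_term _ (admissible_stuffle hu hv)).tendsto_sum_nat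
  refine tendsto_nhds_unique h1 (h2.congr fun N => ?_)
  rw [← sum_map_trunc_eq_sum_range, ← trunc_mul_trunc, trunc, trunc]

/-- The product of two convergent values computed in two ways. -/
theorem double_shuffle {u v : Index} (hu : admissible u = true) (hv : admissible v = true) :
    ((shuffle (word u) (word v)).map val).sum = ((stuffle u v).map (val <| word ·)).sum := by
  rw [← val_mul_val_eq_stuffle hu hv, val_mul_val_eq_shuffle (convergent_word hu)
    (convergent_word hv) (good_word u) (good_word v)]

theorem hasSum_of_eq {f g : ℕ → ℝ} {a : ℝ} (hfg : ∀ n, f n = g n) (hf : HasSum f a) :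
    HasSum g a := (funext hfg : f = g) ▸ hf

theorem hasSum_sub_shift {g : ℕ → ℝ} (hg : Filter.Tendsto g Filter.atTop (nhds 0)) (j : ℕ)
    (hnonneg : ∀ i, 0 ≤ g i - g (i + j)) :
    HasSum (fun i => g i - g (i + j)) (∑ i ∈ Finset.range j, g i) := by
  rw [hasSum_iff_tendsto_nat_of_nonneg hnonneg]
  have hlim : Filter.Tendsto
      (fun N => ∑ i ∈ Finset.range j, g i - ∑ i ∈ Finset.range j, g (N + i)) Filter.atTop
      (nhds (∑ i ∈ Finset.range j, g i - ∑ i ∈ Finset.range j, 0)) :=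
    tendsto_const_nhds.sub (tendsto_finsetSum _ fun i _ =>
      hg.comp (Filter.tendsto_add_atTop_nat i))
  simp only [Finset.sum_const_zero, sub_zero] at hlim
  refine hlim.congr fun N => ?_
  have h1 := Finset.sum_range_add g N j
  have h2 := Finset.sum_range_add g j N
  rw [Finset.sum_sub_distrib]
  simp only [add_comm _ j] at h1 h2 ⊢
  linarith

theorem term_depth_one (k : ℕ) (p : Bool) {n : ℕ} (hn : n ≠ 0) :
    term [(k, p)] n = if n.bodd = p then 1 / (n : ℝ) ^ (k + 1) else 0 := by
  obtain ⟨n, rfl⟩ := Nat.exists_eq_succ_of_ne_zero hn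
  rw [term_cons, trunc_nil_succ]

theorem term_cons_zero (x : ℕ × Bool) (m : Index) : term (x :: m) 0 = 0 := by
  obtain ⟨k, p⟩ := x
  simp [term_cons]

theorem hasSum_harmonic_tail (p : Bool) {j : ℕ} (hj : j.bodd = false) (hpos : j ≠ 0) :
    HasSum (fun i => term [(0, p)] i / ((j : ℝ) + i)) (trunc [(0, p)] (j + 1) / j) := by
  set g : ℕ → ℝ := term [(0, p)]
  have hg : ∀ i, g (i + 1) = if (i + 1).bodd = p then 1 / ((i : ℝ) + 1) else 0 := fun i => by
    have := term_depth_one 0 p i.succ_ne_zero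
    simpa using this
  have hj0 : (0 : ℝ) < j := by exact_mod_cast hpos.bot_lt
  have hdiff : ∀ i, g (i + 1) - g (i + j + 1) = j * (g (i + 1) / ((j : ℝ) + (i + 1 : ℕ))) := by
    intro i
    have hb : (i + j + 1).bodd = (i + 1).bodd := by
      rw [add_right_comm, Nat.bodd_add, hj, Bool.xor_false]
    rw [hg, hg, hb]
    split_ifs
    · push_cast
      field_simp
      ring
    · simp
  have hlim : Filter.Tendsto (fun i => g (i + 1)) Filter.atTop (nhds 0) := by
    refine squeeze_zero (fun i => term_nonneg _ _) (fun i => ?_)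
      tendsto_one_div_add_atTop_nhds_zero_nat
    rw [hg]
    split_ifs
    · exact le_rfl
    · positivity
  have hsum := hasSum_sub_shift hlim j fun i => by
    have h1 : 0 ≤ g (i + 1) := term_nonneg _ _
    rw [hdiff]
    positivity
  simp only [hdiff] at hsum
  have h2 := hsum.div_const (j : ℝ)
  simp only [mul_div_cancel_left₀ _ hj0.ne'] at h2
  rw [← hasSum_nat_add_iff' 1, trunc, Finset.sum_range_succ']
  simpa [g, term_cons_zero] using h2

theorem hasSum_antidiagonal {f : ℕ × ℕ → ℝ} {a : ℝ} (hf : HasSum f a) :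
    HasSum (fun n => ∑ x ∈ Finset.HasAntidiagonal.antidiagonal n, f x) a := by
  rw [← Finset.HasAntidiagonal.sigmaAntidiagonalEquivProd.hasSum_iff] at hf
  refine hf.sigma fun n => ?_
  rw [← Finset.sum_finset_coe]
  exact hasSum_fintype _

theorem coeff_sum_series_none_cons (L : List Word) (n : ℕ) :
    PowerSeries.coeff n ((L.map (none :: ·)).map series).sum =
      PowerSeries.coeff n (L.map series).sum / n := by
  induction L with
  | nil => simp
  | cons u L ih =>
    simp only [List.map_cons, List.sum_cons, map_add, ih, add_div]
    rw [series, PowerSeries.coeff_mk, form, one_mul]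

theorem hasSum_of_fiberwise {f : ℕ × ℕ → ℝ} (hf : ∀ x, 0 ≤ f x) {s : ℕ → ℝ} {a : ℝ}
    (hs : ∀ j, HasSum (fun i => f (j, i)) (s j)) (ha : HasSum s a) : HasSum f a := by
  have hsum : Summable f := (summable_prod_of_nonneg hf).mpr
    ⟨fun j => (hs j).summable, ha.summable.congr fun j => ((hs j).tsum_eq).symm⟩
  rw [← (hsum.hasSum.prod_fiberwise hs).unique ha]
  exact hsum.hasSum

/-- The regularized double shuffle relation with the divergent sum of depth and weight one. -/
theorem regularized_double_shuffle (p : Bool) (k : ℕ) (v : Index) :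
    ((shuffle (word [(0, p)]) (word ((k, false) :: v))).map (val <| none :: ·)).sum =
      ((stuffle [(0, p)] v).map (val <| word <| (k + 1, false) :: ·)).sum +
        bif p then 0 else val (word ((k + 2, false) :: v)) := by
  set f : ℕ → ℝ := term ((k, false) :: v) with hf
  have hs : HasSum (fun j => f j * (trunc [(0, p)] (j + 1) / j))
      (((stuffle [(0, p)] v).map (val <| word <| (k + 1, false) :: ·)).sum +
        bif p then 0 else val (word ((k + 2, false) :: v))) := by
    have h1 := hasSum_sum_term ((stuffle [(0, p)] v).map ((k + 1, false) :: ·)) (by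
      simp [admissible])
    rw [List.map_map] at h1
    have h2 : HasSum (fun j => bif p then (0 : ℝ) else term ((k + 2, false) :: v) j)
        (bif p then 0 else val (word ((k + 2, false) :: v))) := by
      cases p with
      | true => exact hasSum_zero
      | false => exact hasSum_term rfl
    refine hasSum_of_eq (fun j => ?_) (h1.add h2)
    rw [sum_map_term_cons, ← trunc_mul_trunc, trunc_succ, hf, term_cons]
    rcases eq_or_ne j 0 with rfl | hj
    · cases p <;> simp [trunc_zero, term_cons]
    · have hj0 : (j : ℝ) ≠ 0 := by exact_mod_cast hj
      rw [term_depth_one 0 p hj]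
      cases p <;> cases hb : j.bodd <;> simp [hb, term_cons] <;> field_simp <;> ring
  have hG := hasSum_antidiagonal (hasSum_of_fiberwise
    (f := fun x : ℕ × ℕ => f x.1 * (term [(0, p)] x.2 / ((x.1 : ℝ) + x.2)))
    (fun x => mul_nonneg (term_nonneg _ _) (div_nonneg (term_nonneg _ _) (by positivity)))
    (fun j => by
      by_cases hj : j.bodd = false ∧ j ≠ 0
      · exact (hasSum_harmonic_tail p hj.1 hj.2).mul_left _
      · have hfj : f j = 0 := by
          rcases not_and_or.mp hj with hj | hj
          · rw [hf, term_cons, if_neg hj]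
          · rw [not_not.mp hj]
            exact term_cons_zero _ _
        simp [hfj, hasSum_zero]) hs)
  have hL := hasSum_coeff_sum_series
    ((shuffle (word [(0, p)]) (word ((k, false) :: v))).map (none :: ·))
    (by simp [Convergent])
  have hmap : ((shuffle (word [(0, p)]) (word ((k, false) :: v))).map (val <| none :: ·)).sum =
      (((shuffle (word [(0, p)]) (word ((k, false) :: v))).map (none :: ·)).map val).sum := by
    rw [List.map_map]
    rfl
  rw [hmap]
  refine hL.unique ?_
  convert hG using 2 with n
  rw [coeff_sum_series_none_cons]
  rw [← series_mul_series (good_word _) (good_word _), mul_comm, PowerSeries.coeff_mul,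
    Finset.sum_div]
  refine Finset.sum_congr rfl fun x hx => ?_
  rw [coeff_series_word, coeff_series_word, ← Finset.HasAntidiagonal.mem_antidiagonal.mp hx]
  push_cast
  ring

theorem val_depth_one_odd (k : ℕ) :
    val (word [(k + 1, true)]) = (2 ^ (k + 2) - 1) * val (word [(k + 1, false)]) := by
  have ho := (hasSum_term (m := [(k + 1, true)]) rfl)
  have he := (hasSum_term (m := [(k + 1, false)]) rfl)
  have hall : HasSum (fun n : ℕ => 1 / (n : ℝ) ^ (k + 2))
      (val (word [(k + 1, true)]) + val (word [(k + 1, false)])) := by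
    refine hasSum_of_eq (fun n => ?_) (ho.add he)
    rcases eq_or_ne n 0 with rfl | hn
    · simp [term_cons_zero]
    · rw [term_depth_one _ _ hn, term_depth_one _ _ hn]
      cases n.bodd <;> simp
  have h2 : HasSum (fun n : ℕ => 1 / ((2 * n : ℕ) : ℝ) ^ (k + 2))
      (val (word [(k + 1, false)])) := by
    have hinj : Function.Injective fun n : ℕ => 2 * n := fun a b h => by simpa using h
    rw [← hinj.hasSum_iff] at he
    · refine hasSum_of_eq (fun n => ?_) he
      rcases eq_or_ne n 0 with rfl | hn
      · simp [term_cons_zero]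
      · simp only [Function.comp_apply]
        rw [term_depth_one _ _ (by positivity)]
        simp
    · intro n hn
      rw [term_cons, if_neg]
      contrapose! hn
      have hdiv := Nat.bodd_add_div2 n
      rw [hn] at hdiv
      exact ⟨n.div2, by simpa using hdiv⟩
  have h3 := h2.unique (hasSum_of_eq (fun n => ?_) (hall.div_const (2 ^ (k + 2))))
  · rw [eq_div_iff (by positivity)] at h3
    linarith
  · push_cast
    rw [mul_pow]
    field_simp

theorem distribution (k : ℕ) {v : Index} (hv : admissible v = true) :
    ((shuffle (word [(k + 1, true)]) (word v)).map val).sum =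
      (2 ^ (k + 2) - 1) * ((shuffle (word [(k + 1, false)]) (word v)).map val).sum := by
  rw [← val_mul_val_eq_shuffle (convergent_word rfl) (convergent_word hv) (good_word _)
    (good_word _), ← val_mul_val_eq_shuffle (convergent_word rfl) (convergent_word hv)
    (good_word _) (good_word _), val_depth_one_odd, mul_assoc]


/-! ### Formal linear combinations of words -/

/-- The value of a formal linear combination of words under a function on words. -/
def eval (f : Word → ℝ) (L : List (ℤ × Word)) : ℝ := (L.map fun x => x.1 * f x.2).sum

def constTerm : List (ℤ × Word) → ℤ
  | [] => 0
  | (c, []) :: L => c + constTerm L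
  | (_, _ :: _) :: L => constTerm L

/-- The terms of a combination whose word starts with `x`, with that letter removed. -/
def tails (x : Option Bool) : List (ℤ × Word) → List (ℤ × Word)
  | [] => []
  | (_, []) :: L => tails x L
  | (c, y :: u) :: L => bif y == x then (c, u) :: tails x L else tails x L

/-- Checks that all coefficients vanish, looking at words of length below `n`. -/
def cancels : ℕ → List (ℤ × Word) → Bool
  | 0, L => L.isEmpty
  | n + 1, L => constTerm L == 0 && cancels n (tails none L) &&
      cancels n (tails (some true) L) && cancels n (tails (some false) L)

theorem eval_nil (f : Word → ℝ) : eval f [] = 0 := rfl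

theorem eval_cons (f : Word → ℝ) (x : ℤ × Word) (L : List (ℤ × Word)) :
    eval f (x :: L) = x.1 * f x.2 + eval f L := by simp [eval]

theorem eval_append (f : Word → ℝ) (L M : List (ℤ × Word)) :
    eval f (L ++ M) = eval f L + eval f M := by simp [eval]

theorem eval_eq_tails (f : Word → ℝ) (L : List (ℤ × Word)) :
    eval f L = constTerm L * f [] + eval (fun u => f (none :: u)) (tails none L) +
      eval (fun u => f (some true :: u)) (tails (some true) L) +
      eval (fun u => f (some false :: u)) (tails (some false) L) := by
  induction L with
  | nil => simp [eval, constTerm, tails]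
  | cons x L ih =>
    obtain ⟨c, u⟩ := x
    rw [eval_cons, ih]
    match u with
    | [] =>
      simp only [constTerm, tails]
      push_cast
      ring
    | none :: u => simp [constTerm, tails, eval_cons]; ring
    | some true :: u => simp [constTerm, tails, eval_cons]; ring
    | some false :: u => simp [constTerm, tails, eval_cons]; ring

theorem eval_eq_zero_of_cancels {n : ℕ} {L : List (ℤ × Word)} (hL : cancels n L = true)
    (f : Word → ℝ) : eval f L = 0 := by
  induction n generalizing L f with
  | zero =>
    rw [cancels, List.isEmpty_iff] at hL
    rw [hL, eval_nil]
  | succ n ih =>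
    simp only [cancels, Bool.and_eq_true, beq_iff_eq] at hL
    obtain ⟨⟨⟨h0, h1⟩, h2⟩, h3⟩ := hL
    rw [eval_eq_tails, h0, ih h1, ih h2, ih h3]
    simp

/-- The sum of a list of words, scaled by an integer. -/
def scaled (c : ℤ) (L : List Word) : List (ℤ × Word) := L.map fun u => (c, u)

theorem eval_scaled (f : Word → ℝ) (c : ℤ) (L : List Word) :
    eval f (scaled c L) = c * (L.map f).sum := by
  induction L with
  | nil => simp [eval, scaled]
  | cons u L ih =>
    rw [scaled, List.map_cons, eval_cons, ← scaled, ih, List.map_cons, List.sum_cons]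
    ring

/-- The families of linear relations between values of words. -/
inductive Relation
  | double (u v : Index)
  | regularized (p : Bool) (k : ℕ) (v : Index)
  | distribution (k : ℕ) (v : Index)

def Relation.valid : Relation → Bool
  | .double u v => admissible u && admissible v
  | .regularized _ _ _ => true
  | .distribution _ v => admissible v

/-- The combination of words asserted to vanish, multiplied by `c`. -/
def Relation.combination (c : ℤ) : Relation → List (ℤ × Word)
  | .double u v => scaled c (shuffle (word u) (word v)) ++ scaled (-c) ((stuffle u v).map word)
  | .regularized p k v =>
    scaled c ((shuffle (word [(0, p)]) (word ((k, false) :: v))).map (none :: ·)) ++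
      scaled (-c) (((stuffle [(0, p)] v).map fun m => word ((k + 1, false) :: m)) ++
        bif p then [] else [word ((k + 2, false) :: v)])
  | .distribution k v =>
    scaled (c * (2 ^ (k + 2) - 1)) (shuffle (word [(k + 1, false)]) (word v)) ++
      scaled (-c) (shuffle (word [(k + 1, true)]) (word v))

theorem Relation.eval_combination {r : Relation} (hr : r.valid = true) (c : ℤ) :
    eval val (r.combination c) = 0 := by
  cases r with
  | double u v =>
    simp only [valid, Bool.and_eq_true] at hr
    rw [combination, eval_append, eval_scaled, eval_scaled, double_shuffle hr.1 hr.2,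
      List.map_map]
    push_cast
    simp [Function.comp_def]
  | regularized p k v =>
    have := regularized_double_shuffle p k v
    rw [combination, eval_append, eval_scaled, eval_scaled, List.map_append, List.sum_append,
      List.map_map, List.map_map]
    simp only [Function.comp_def]
    rw [this]
    cases p <;> simp
  | distribution k v =>
    rw [combination, eval_append, eval_scaled, eval_scaled, DoubleShuffle.distribution k hr]
    push_cast
    ring

def combine (C : List (ℤ × Relation)) : List (ℤ × Word) :=
  C.flatMap fun x => x.2.combination x.1

theorem eval_combine {C : List (ℤ × Relation)} (hC : (C.all fun x => x.2.valid) = true) :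
    eval val (combine C) = 0 := by
  induction C with
  | nil => rfl
  | cons x C ih =>
    simp only [List.all_cons, Bool.and_eq_true] at hC
    rw [combine, List.flatMap_cons, eval_append, Relation.eval_combination hC.1, ← combine,
      ih hC.2, add_zero]

/-- The indices in the expansion of `(∑ 1/i)² ∑ 1/j²` over odd `i` and even `j` below a bound. -/
def harmonicProduct : List Index :=
  (stuffle [(0, true)] [(0, true)]).flatMap (stuffle · [(1, false)])

/-- The combination, multiplied by `c`, expressing the sum in weight six by simpler values. -/
def target (c : ℤ) : List (ℤ × Word) :=
  scaled (16 * c) ((harmonicProduct.map fun m => word ((1, false) :: m)) ++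
    (stuffle [(0, true)] [(0, true)]).map fun m => word ((3, false) :: m)) ++
  (scaled (-360 * c) [word [(5, false)]] ++
  (scaled (112 * c) ((stuffle [(2, false)] [(2, false)]).map word) ++
  scaled (-24 * c) [word [(4, false), (0, true)]]))

/-- Multiples of relations whose sum is `-346500` times the target. -/
def certificate : List (ℤ × Relation) := [
    (-23056140, .regularized true 3 []),
    (41852160, .regularized true 2 [(0, true)]),
    (45424080, .regularized true 2 [(0, false)]),
    (80049288, .regularized true 1 [(1, true)]),
    (16396800, .regularized true 1 [(0, true), (0, false)]),
    (17304000, .regularized true 1 [(0, true), (0, true)]),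
    (-28191840, .regularized true 1 [(1, false)]),
    (16396800, .regularized true 1 [(0, false), (0, true)]),
    (-8712000, .regularized true 1 [(0, false), (0, false)]),
    (6812400, .regularized true 0 [(1, true), (0, false)]),
    (9246000, .regularized true 0 [(1, true), (0, true)]),
    (15724800, .regularized true 0 [(0, true), (1, false)]),
    (-13548000, .regularized true 0 [(0, true), (1, true)]),
    (-44494800, .regularized true 0 [(2, false)]),
    (13584000, .regularized true 0 [(1, false), (0, true)]),
    (-6098400, .regularized true 0 [(1, false), (0, false)]),
    (-15981600, .regularized true 0 [(0, false), (1, true)]),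
    (-21573360, .regularized false 2 [(0, true)]),
    (-79322088, .regularized false 1 [(1, true)]),
    (5227200, .regularized false 1 [(0, true), (0, false)]),
    (-26227200, .regularized false 1 [(0, true), (0, true)]),
    (5227200, .regularized false 1 [(0, false), (0, true)]),
    (-3709200, .regularized false 0 [(2, true)]),
    (-1544400, .regularized false 0 [(1, true), (0, false)]),
    (-12915600, .regularized false 0 [(1, true), (0, true)]),
    (4610400, .regularized false 0 [(0, true), (1, true)]),
    (871200, .regularized false 0 [(1, false), (0, true)]),
    (15981600, .regularized false 0 [(0, false), (1, true)]),
    (58632215, .double [(1, true)] [(3, true)]),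
    (11528070, .double [(1, true)] [(3, false)]),
    (-66686256, .double [(1, true)] [(2, false), (0, true)]),
    (52192560, .double [(1, true)] [(2, true), (0, false)]),
    (186313680, .double [(1, true)] [(2, true), (0, true)]),
    (-51900000, .double [(1, true)] [(2, false), (0, false)]),
    (-37308312, .double [(1, true)] [(1, false), (1, true)]),
    (-24490548, .double [(1, true)] [(1, true), (1, false)]),
    (-10774800, .double [(1, true)] [(1, true), (0, false), (0, true)]),
    (16321200, .double [(1, true)] [(1, false), (0, true), (0, false)]),
    (20613600, .double [(1, true)] [(1, false), (0, true), (0, true)]),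
    (-15703200, .double [(1, true)] [(1, true), (0, false), (0, false)]),
    (38665060, .double [(1, true)] [(1, true), (1, true)]),
    (-498060, .double [(1, true)] [(1, false), (1, false)]),
    (12238800, .double [(1, true)] [(1, false), (0, false), (0, true)]),
    (-19724400, .double [(1, true)] [(1, true), (0, true), (0, false)]),
    (-3484800, .double [(1, true)] [(1, true), (0, true), (0, true)]),
    (-3484800, .double [(1, true)] [(1, false), (0, false), (0, false)]),
    (43550793, .double [(1, false)] [(3, true)]),
    (-259249872, .double [(1, false)] [(2, false), (0, true)]),
    (-80171268, .double [(1, false)] [(1, false), (1, true)]),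
    (-23056140, .double [(1, false)] [(1, true), (1, false)]),
    (14140800, .double [(1, false)] [(1, true), (0, false), (0, true)]),
    (-6098400, .double [(1, false)] [(1, false), (0, true), (0, false)]),
    (-8320800, .double [(1, false)] [(1, false), (0, true), (0, true)]),
    (6098400, .double [(1, false)] [(1, true), (0, false), (0, false)]),
    (95662716, .double [(1, false)] [(1, true), (1, true)]),
    (-6098400, .double [(1, false)] [(1, false), (0, false), (0, true)]),
    (6098400, .double [(1, false)] [(1, true), (0, true), (0, false)]),
    (6098400, .double [(1, false)] [(1, true), (0, true), (0, true)]),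
    (-60612215, .double [(2, true)] [(2, true)]),
    (54885360, .double [(2, true)] [(1, false), (0, true)]),
    (72887760, .double [(2, true)] [(1, true), (0, false)]),
    (-61233360, .double [(2, true)] [(1, true), (0, true)]),
    (-64718160, .double [(2, true)] [(1, false), (0, false)]),
    (-7038580, .double [(2, false)] [(2, true)]),
    (38808000, .double [(2, false)] [(2, false)]),
    (66743520, .double [(2, false)] [(1, false), (0, true)]),
    (-2752800, .double [(1, false), (0, true)] [(1, false), (0, true)]),
    (-13508400, .double [(1, true), (0, false)] [(1, false), (0, true)]),
    (7416000, .double [(1, true), (0, false)] [(1, true), (0, false)]),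
    (-9426000, .double [(1, true), (0, true)] [(1, false), (0, true)]),
    (18853200, .double [(1, true), (0, true)] [(1, true), (0, false)]),
    (1306800, .double [(1, true), (0, true)] [(1, true), (0, true)]),
    (9583200, .double [(1, false), (0, false)] [(1, false), (0, true)]),
    (-3484800, .double [(1, false), (0, false)] [(1, true), (0, false)]),
    (-3484800, .double [(1, false), (0, false)] [(1, true), (0, true)]),
    (-792000, .distribution 1 [(2, true)]),
    (-5544000, .distribution 1 [(2, false)]),
    (-7227600, .distribution 1 [(1, false), (0, true)]),
    (7227600, .distribution 1 [(1, true), (0, false)]),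
    (7227600, .distribution 1 [(1, true), (0, true)]),
    (-2495626, .distribution 0 [(3, true)]),
    (8479824, .distribution 0 [(2, false), (0, true)]),
    (1933152, .distribution 0 [(1, false), (1, true)]),
    (-4314360, .distribution 0 [(1, true), (1, false)]),
    (-15724800, .distribution 0 [(1, true), (0, false), (0, true)]),
    (6787200, .distribution 0 [(1, false), (0, true), (0, true)]),
    (-1250072, .distribution 0 [(1, true), (1, true)]),
    (1980000, .distribution 4 [])]

theorem cancels_certificate : cancels 7 (target 346500 ++ combine certificate) = true := by
  decide +kernel

theorem valid_certificate : (certificate.all fun x => x.2.valid) = true := by decide +kernel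

theorem weight_six_relation :
    16 * ((harmonicProduct.map fun m => val (word ((1, false) :: m))).sum +
      ((stuffle [(0, true)] [(0, true)]).map fun m => val (word ((3, false) :: m))).sum) =
    360 * val (word [(5, false)]) - 112 * val (word [(2, false)]) ^ 2 +
      24 * val (word [(4, false), (0, true)]) := by
  have h1 := eval_eq_zero_of_cancels cancels_certificate val
  rw [eval_append, eval_combine valid_certificate, add_zero, target] at h1
  simp only [eval_append, eval_scaled, List.map_append, List.sum_append, List.map_map,
    Function.comp_def] at h1
  rw [sq, val_mul_val_eq_stuffle rfl rfl]
  push_cast at h1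
  simp only [List.map_cons, List.map_nil, List.sum_cons, List.sum_nil, add_zero] at h1
  linarith

theorem sum_map_trunc_flatMap (L : List Index) (v : Index) (N : ℕ) :
    ((L.flatMap (stuffle · v)).map (trunc · N)).sum = (L.map (trunc · N)).sum * trunc v N := by
  induction L with
  | nil => simp
  | cons m L ih =>
    rw [List.flatMap_cons, List.map_append, List.sum_append, ih, ← trunc_mul_trunc,
      List.map_cons, List.sum_cons, add_mul]

/-- A series supported on positive even numbers, reindexed. -/
theorem hasSum_even {f : ℕ → ℝ} {a : ℝ} (hf : HasSum f a) (hodd : ∀ n, n.bodd = true → f n = 0)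
    (h0 : f 0 = 0) : HasSum (fun k => f (2 * k + 2)) a := by
  have hinj : Function.Injective fun k : ℕ => 2 * k + 2 := fun a b hab => by simpa using hab
  refine (hinj.hasSum_iff fun n hn => ?_).mpr hf
  cases hb : n.bodd with
  | true => exact hodd n hb
  | false =>
    have hdiv := Nat.bodd_add_div2 n
    rw [hb, Bool.toNat_false, zero_add] at hdiv
    rcases hk : n.div2 with _ | k
    · rw [← hdiv, hk]
      exact h0
    · exact absurd ⟨k, by simp only; omega⟩ hn

/-! ### Harmonic sums as nested sums -/

theorem h_eq_trunc (k : ℕ) : h k = trunc [(0, true)] (2 * k) := by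
  induction k with
  | zero => simp [h, trunc_zero]
  | succ k ih =>
    rw [show 2 * (k + 1) = 2 * k + 1 + 1 by ring, trunc_succ, trunc_succ, ← ih,
      term_depth_one 0 true (2 * k).succ_ne_zero, h, Finset.sum_range_succ, ← h]
    simp [term_cons]

theorem H2_eq_trunc (k : ℕ) : H2 k = 4 * trunc [(1, false)] (2 * k + 1) := by
  induction k with
  | zero => simp [H2, trunc_succ, trunc_zero, term_cons_zero]
  | succ k ih =>
    rw [show 2 * (k + 1) + 1 = 2 * k + 1 + 1 + 1 by ring, trunc_succ, trunc_succ, mul_add, mul_add,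
      ← ih, term_depth_one 1 false (2 * k + 1).succ_ne_zero, H2, Finset.sum_range_succ, ← H2]
    simp [term_cons]
    field_simp
    ring

theorem zeta_eq_val (s : ℕ) : zeta (s + 2) = 2 ^ (s + 2) * val (word [(s + 1, false)]) := by
  have h1 := hasSum_even (hasSum_term (m := [(s + 1, false)]) rfl) (fun n hn => by
    rw [term_cons, if_neg (by simp [hn])]) (term_cons_zero _ _)
  refine (hasSum_of_eq (fun k => ?_) (h1.mul_left (2 ^ (s + 2)))).tsum_eq
  rw [term_depth_one _ _ (2 * k + 1).succ_ne_zero]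
  simp only [Nat.succ_eq_add_one]
  push_cast
  rw [show 2 * (k : ℝ) + 1 + 1 = 2 * (k + 1) by ring, mul_pow]
  simp
  field_simp

theorem hasSum_h_div :
    HasSum (fun k : ℕ => h (k + 1) / ((k : ℝ) + 1) ^ 5)
      (32 * val (word [(4, false), (0, true)])) := by
  have h1 := hasSum_even (hasSum_term (m := [(4, false), (0, true)]) rfl) (fun n hn => by
    rw [term_cons, if_neg (by simp [hn])]) (term_cons_zero _ _)
  refine hasSum_of_eq (fun k => ?_) (h1.mul_left 32)
  rw [h_eq_trunc, term_cons, show 2 * (k + 1) = 2 * k + 2 by ring]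
  simp
  field_simp
  ring

theorem hasSum_H2_mul_h_sq :
    HasSum (fun k : ℕ => H2 (k + 1) * (h (k + 1)) ^ 2 / ((k : ℝ) + 1) ^ 2)
      (16 * ((harmonicProduct.map fun m => val (word ((1, false) :: m))).sum +
        ((stuffle [(0, true)] [(0, true)]).map fun m => val (word ((3, false) :: m))).sum)) := by
  have h1 := hasSum_sum_term (harmonicProduct.map ((1, false) :: ·)) (by simp [admissible])
  have h2 := hasSum_sum_term ((stuffle [(0, true)] [(0, true)]).map ((3, false) :: ·))
    (by simp [admissible])
  have h3 := hasSum_even (h1.add h2) (fun n hn => by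
    rw [sum_map_term_cons, sum_map_term_cons]
    simp [hn]) (by
    rw [sum_map_term_cons, sum_map_term_cons]
    simp)
  simp only [sum_map_term_cons] at h3
  simp only [List.map_map, Function.comp_def] at h3
  refine hasSum_of_eq (fun k => ?_) (h3.mul_left 16)
  have hprod : (harmonicProduct.map (trunc · (2 * k + 2))).sum =
      trunc [(0, true)] (2 * k + 2) ^ 2 * trunc [(1, false)] (2 * k + 2) := by
    rw [harmonicProduct, sq, trunc_mul_trunc, sum_map_trunc_flatMap]
  rw [hprod, ← trunc_mul_trunc, h_eq_trunc, H2_eq_trunc,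
    show 2 * (k + 1) = 2 * k + 2 by ring, trunc_succ _ (2 * k + 2),
    term_depth_one _ _ (2 * k + 1).succ_ne_zero]
  simp
  field_simp
  ring

end DoubleShuffle

theorem stmt16 :
    Summable (fun k : ℕ => h (k + 1) / ((k : ℝ) + 1) ^ 5) ∧
    HasSum (fun k : ℕ => H2 (k + 1) * (h (k + 1)) ^ 2 / ((k : ℝ) + 1) ^ 2)
      ((45 / 8) * zeta 6 - (7 / 4) * (zeta 3) ^ 2
        + (3 / 4) * (∑' k : ℕ, h (k + 1) / ((k : ℝ) + 1) ^ 5)) := by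
  refine ⟨DoubleShuffle.hasSum_h_div.summable, ?_⟩
  rw [DoubleShuffle.hasSum_h_div.tsum_eq]
  convert DoubleShuffle.hasSum_H2_mul_h_sq using 1
  rw [DoubleShuffle.weight_six_relation, DoubleShuffle.zeta_eq_val 4, DoubleShuffle.zeta_eq_val 1]
  ring
end

section
/- The series ∑_{k=1}^∞ H_k·H_k^{(2)}·h_k/k² converges and equals (45/8)·ζ(6) - (49/32)·ζ(3)² + (1/2)·ζ(2)·∑_{k=1}^∞ h_k/k³ + (3/8)·∑_{k=1}^∞ h_k/k⁵. -/
open Finset Real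

open Filter Topology

/-- The normalised central binomial weight `n!² / ((n - k)! (n + k)!)`, which vanishes for `k > n`. -/
noncomputable def binomWeight (n k : ℕ) : ℝ :=
  ∏ i ∈ range k, ((n : ℝ) - i) / ((n : ℝ) + i + 1)

namespace binomWeight

lemma zero_right (n : ℕ) : binomWeight n 0 = 1 := by simp [binomWeight]

lemma succ_right (n k : ℕ) :
    binomWeight n (k + 1) = binomWeight n k * (((n : ℝ) - k) / ((n : ℝ) + k + 1)) :=
  prod_range_succ _ _

lemma eq_zero {n k : ℕ} (hk : n < k) : binomWeight n k = 0 :=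
  prod_eq_zero (mem_range.2 hk) (by simp)

lemma nonneg (n k : ℕ) : 0 ≤ binomWeight n k := by
  rcases lt_or_ge n k with hk | hk
  · exact (eq_zero hk).ge
  · refine prod_nonneg fun i hi => div_nonneg ?_ (by positivity)
    have : (i : ℝ) ≤ n := by exact_mod_cast (mem_range.1 hi).le.trans hk
    linarith

lemma succ_left_mul (n k : ℕ) :
    binomWeight (n + 1) k * ((n + 1 - k) * (n + 1 + k)) = (n + 1) ^ 2 * binomWeight n k := by
  induction k with
  | zero => simp [zero_right]; ring
  | succ k ih =>
    rw [succ_right, succ_right]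
    have h1 : (n : ℝ) + 1 + k + 1 ≠ 0 := by positivity
    have h2 : (n : ℝ) + k + 1 ≠ 0 := by positivity
    push_cast
    have e : (n + 1 : ℝ) ^ 2 * (binomWeight n k * ((n - k) / (n + k + 1)))
        = ((n + 1) ^ 2 * binomWeight n k) * ((n - k) / (n + k + 1)) := by ring
    rw [e, ← ih]
    field_simp
    ring

lemma succ_left_sub (n k : ℕ) :
    binomWeight (n + 1) k - binomWeight n k
      = (k : ℝ) ^ 2 * (binomWeight (n + 1) k / ((n : ℝ) + 1) ^ 2) := by
  have := succ_left_mul n k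
  have h1 : (n : ℝ) + 1 ≠ 0 := by positivity
  field_simp
  linarith

/-- The three-term relation in `k` between consecutive rows. -/
lemma sub_shift (n k : ℕ) :
    (binomWeight n k - binomWeight n (k + 2)) / (2 * n + 1)
      = 2 / (k + 1) * (binomWeight (n + 1) (k + 1) - binomWeight n (k + 1)) := by
  rw [succ_left_sub]
  have hm := succ_left_mul n k
  have h1 : (n : ℝ) + 1 ≠ 0 := by positivity
  have h2 : (n : ℝ) + k + 1 ≠ 0 := by positivity
  have h3 : (n : ℝ) + 1 + k + 1 ≠ 0 := by positivity
  have h4 : (2 * n : ℝ) + 1 ≠ 0 := by positivity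
  have h5 : (n : ℝ) + 1 + k ≠ 0 := by positivity
  have h6 : (k : ℝ) + 1 ≠ 0 := by positivity
  have e : binomWeight n k = binomWeight (n + 1) k * ((n + 1 - k) * (n + 1 + k)) / (n + 1) ^ 2 := by
    field_simp; linarith
  rw [succ_right n (k + 1), succ_right n k, succ_right (n + 1) k, e]
  push_cast
  field_simp
  ring

lemma add_shift (n k : ℕ) :
    binomWeight n k + binomWeight n (k + 2)
      = 2 * (2 * n + 1) / (n + 1) * binomWeight (n + 1) (k + 1) - 2 * binomWeight n (k + 1) := by
  have hm := succ_left_mul n k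
  have h1 : (n : ℝ) + 1 ≠ 0 := by positivity
  have h2 : (n : ℝ) + k + 1 ≠ 0 := by positivity
  have h3 : (n : ℝ) + 1 + k + 1 ≠ 0 := by positivity
  have h5 : (n : ℝ) + 1 + k ≠ 0 := by positivity
  have e : binomWeight n k = binomWeight (n + 1) k * ((n + 1 - k) * (n + 1 + k)) / (n + 1) ^ 2 := by
    field_simp; linarith
  rw [succ_right n (k + 1), succ_right n k, succ_right (n + 1) k, e]
  push_cast
  field_simp
  ring

lemma tendsto_one (k : ℕ) : Tendsto (fun n => binomWeight n k) atTop (𝓝 1) := by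
  have : ∀ i : ℕ, Tendsto (fun n : ℕ => ((n : ℝ) - i) / ((n : ℝ) + i + 1)) atTop (𝓝 1) := by
    intro i
    have h0 : Tendsto (fun n : ℕ => 1 - (2 * (i : ℝ) + 1) / ((n : ℝ) + (i + 1))) atTop (𝓝 (1 - 0)) :=
      tendsto_const_nhds.sub (tendsto_const_nhds.div_atTop
        (tendsto_atTop_add_const_right _ _ tendsto_natCast_atTop_atTop))
    rw [sub_zero] at h0
    refine h0.congr fun n => ?_
    have : (n : ℝ) + (i + 1) ≠ 0 := by positivity
    field_simp
    ring
  simpa [binomWeight] using tendsto_finsetProd (range k) fun i _ => this i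

end binomWeight

lemma H_succ (n : ℕ) : H (n + 1) = H n + 1 / ((n : ℝ) + 1) := sum_range_succ _ _
lemma H2_succ (n : ℕ) : H2 (n + 1) = H2 n + 1 / ((n : ℝ) + 1) ^ 2 := sum_range_succ _ _
lemma H3_succ (n : ℕ) : H3 (n + 1) = H3 n + 1 / ((n : ℝ) + 1) ^ 3 := sum_range_succ _ _
lemma h_succ (n : ℕ) : h (n + 1) = h n + 1 / (2 * (n : ℝ) + 1) := sum_range_succ _ _
lemma h_eq_sum_binomWeight (n : ℕ) :
    h n = ∑ i ∈ range n, 2 / (2 * (i : ℝ) + 1) * binomWeight n (2 * i + 1) := by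
  induction n with
  | zero => simp [h]
  | succ n ih =>
    have e : ∑ i ∈ range n, 2 / (2 * (i : ℝ) + 1) * binomWeight n (2 * i + 1)
        = ∑ i ∈ range (n + 1), 2 / (2 * (i : ℝ) + 1) * binomWeight n (2 * i + 1) := by
      rw [sum_range_succ, binomWeight.eq_zero (by omega : n < 2 * n + 1)]; simp
    rw [h_succ, ih, e, eq_comm, ← sub_eq_iff_eq_add', ← sum_sub_distrib]
    have t : ∀ i ∈ range (n + 1), 2 / (2 * (i : ℝ) + 1) * binomWeight (n + 1) (2 * i + 1)
        - 2 / (2 * (i : ℝ) + 1) * binomWeight n (2 * i + 1)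
        = binomWeight n (2 * i) / (2 * n + 1) - binomWeight n (2 * (i + 1)) / (2 * n + 1) := by
      intro i _
      have := binomWeight.sub_shift n (2 * i)
      push_cast at this
      rw [← mul_sub, ← this, sub_div]; rfl
    rw [sum_congr rfl t, sum_range_sub' (fun i => binomWeight n (2 * i) / (2 * (n : ℝ) + 1)),
      binomWeight.eq_zero (by omega : n < 2 * (n + 1))]
    simp [binomWeight.zero_right]

lemma H_sub_h_eq_sum_binomWeight (n : ℕ) :
    H n - h n = ∑ i ∈ range n, 1 / ((i : ℝ) + 1) * binomWeight n (2 * i + 2) := by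
  induction n with
  | zero => simp [h, H]
  | succ n ih =>
    have e : ∑ i ∈ range n, 1 / ((i : ℝ) + 1) * binomWeight n (2 * i + 2)
        = ∑ i ∈ range (n + 1), 1 / ((i : ℝ) + 1) * binomWeight n (2 * i + 2) := by
      rw [sum_range_succ, binomWeight.eq_zero (by omega : n < 2 * n + 2)]; simp
    have t : ∀ i ∈ range (n + 1), 1 / ((i : ℝ) + 1) * binomWeight (n + 1) (2 * i + 2)
        - 1 / ((i : ℝ) + 1) * binomWeight n (2 * i + 2)
        = binomWeight n (2 * i + 1) / (2 * n + 1)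
          - binomWeight n (2 * (i + 1) + 1) / (2 * n + 1) := by
      intro i _
      have := binomWeight.sub_shift n (2 * i + 1)
      push_cast at this
      rw [← mul_sub, ← sub_div, show 2 * (i + 1) + 1 = 2 * i + 1 + 2 by ring, this]
      congr 1
      field_simp; ring
    have s : ∑ i ∈ range (n + 1), 1 / ((i : ℝ) + 1) * binomWeight (n + 1) (2 * i + 2)
        - ∑ i ∈ range (n + 1), 1 / ((i : ℝ) + 1) * binomWeight n (2 * i + 2)
        = 1 / ((n : ℝ) + 1) - 1 / (2 * n + 1) := by
      rw [← sum_sub_distrib, sum_congr rfl t,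
        sum_range_sub' (fun i => binomWeight n (2 * i + 1) / (2 * (n : ℝ) + 1)),
        binomWeight.eq_zero (by omega : n < 2 * (n + 1) + 1)]
      simp only [mul_zero, zero_add, binomWeight.succ_right n 0, binomWeight.zero_right]
      have h1 : (n : ℝ) + 1 ≠ 0 := by positivity
      have h4 : (2 * n : ℝ) + 1 ≠ 0 := by positivity
      push_cast
      field_simp
      ring
    rw [h_succ, H_succ]
    linarith [ih, e, s]

lemma H_mul_h_eq_sum_binomWeight (n : ℕ) :
    H n * h n = ∑ i ∈ range n, (4 * h (i + 1) / ((i : ℝ) + 1) * binomWeight n (2 * i + 2)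
      + 2 * (H (2 * i) + H (2 * i + 1)) / (2 * (i : ℝ) + 1) * binomWeight n (2 * i + 1)) := by
  induction n with
  | zero => simp [h, H]
  | succ n ih =>
    set w := binomWeight n with hw
    have hz : ∀ k, n < k → w k = 0 := fun k hk => binomWeight.eq_zero hk
    have e : H n * h n = ∑ i ∈ range (n + 1), (4 * h (i + 1) / ((i : ℝ) + 1) * w (2 * i + 2)
      + 2 * (H (2 * i) + H (2 * i + 1)) / (2 * (i : ℝ) + 1) * w (2 * i + 1)) := by
      rw [sum_range_succ, hz _ (by omega : n < 2 * n + 2), hz _ (by omega : n < 2 * n + 1), ih]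
      simp
    have h4 : (2 * n : ℝ) + 1 ≠ 0 := by positivity
    have h1 : (n : ℝ) + 1 ≠ 0 := by positivity
    have t : ∀ i ∈ range (n + 1),
        (4 * h (i + 1) / ((i : ℝ) + 1) * binomWeight (n + 1) (2 * i + 2)
          + 2 * (H (2 * i) + H (2 * i + 1)) / (2 * (i : ℝ) + 1) * binomWeight (n + 1) (2 * i + 1))
        - (4 * h (i + 1) / ((i : ℝ) + 1) * w (2 * i + 2)
          + 2 * (H (2 * i) + H (2 * i + 1)) / (2 * (i : ℝ) + 1) * w (2 * i + 1))
        = ((4 * h i * w (2 * i + 1) + (H (2 * i) + H (2 * i + 1)) * w (2 * i))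
            - (4 * h (i + 1) * w (2 * (i + 1) + 1)
              + (H (2 * (i + 1)) + H (2 * (i + 1) + 1)) * w (2 * (i + 1)))
            + 2 * (2 / (2 * (i : ℝ) + 1) * w (2 * i + 1)) + 1 / ((i : ℝ) + 1) * w (2 * i + 2)
            + (1 / (2 * (i : ℝ) + 1) + 1 / (2 * ((i + 1 : ℕ) : ℝ) + 1)) * w (2 * i + 2))
              / (2 * n + 1) := by
      intro i _
      have s1 := binomWeight.sub_shift n (2 * i)
      have s2 := binomWeight.sub_shift n (2 * i + 1)
      push_cast at s1 s2
      have a1 : H (2 * (i + 1)) = H (2 * i) + 1 / (2 * (i : ℝ) + 1) + 1 / (2 * (i : ℝ) + 2) := by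
        rw [show 2 * (i + 1) = 2 * i + 1 + 1 by ring, H_succ, H_succ]; push_cast; ring
      have a2 : H (2 * (i + 1) + 1)
          = H (2 * i + 1) + 1 / (2 * (i : ℝ) + 2) + 1 / (2 * (i : ℝ) + 3) := by
        rw [show 2 * (i + 1) + 1 = 2 * i + 1 + 1 + 1 by ring, H_succ, H_succ]; push_cast; ring
      rw [a1, a2, h_succ, show 2 * (i + 1) + 1 = 2 * i + 1 + 2 by ring,
        show 2 * (i + 1) = 2 * i + 2 by ring]
      have p1 : (i : ℝ) + 1 ≠ 0 := by positivity
      have p2 : (2 * i : ℝ) + 1 ≠ 0 := by positivity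
      have p3 : (2 * i : ℝ) + 3 ≠ 0 := by positivity
      have q1 : binomWeight (n + 1) (2 * i + 1)
          = w (2 * i + 1) + (2 * i + 1) / 2 * ((w (2 * i) - w (2 * i + 2)) / (2 * n + 1)) := by
        rw [s1]; field_simp; ring
      have q2 : binomWeight (n + 1) (2 * i + 2)
          = w (2 * i + 2) + (i + 1) * ((w (2 * i + 1) - w (2 * i + 1 + 2)) / (2 * n + 1)) := by
        rw [s2, show 2 * i + 1 + 1 = 2 * i + 2 by ring]; field_simp; ring
      rw [q1, q2]
      push_cast
      rw [show (2 * (i : ℝ) + 2) = 2 * (i + 1) by ring]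
      have p4 : (2 * ((i : ℝ) + 1)) + 1 ≠ 0 := by positivity
      field_simp
      ring
    have o : ∑ i ∈ range (n + 1), 1 / (2 * (i : ℝ) + 1) * (w (2 * i) + w (2 * i + 2))
        = (n * h n + 1) / (n + 1) := by
      have o1 := h_eq_sum_binomWeight (n + 1)
      have o2 : h n = ∑ i ∈ range (n + 1), 2 / (2 * (i : ℝ) + 1) * w (2 * i + 1) := by
        rw [sum_range_succ, hz _ (by omega : n < 2 * n + 1), h_eq_sum_binomWeight n]; simp [hw]
      have : ∀ i ∈ range (n + 1), 1 / (2 * (i : ℝ) + 1) * (w (2 * i) + w (2 * i + 2))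
          = (2 * n + 1) / (n + 1) * (2 / (2 * (i : ℝ) + 1) * binomWeight (n + 1) (2 * i + 1))
            - 2 / (2 * (i : ℝ) + 1) * w (2 * i + 1) := by
        intro i _
        rw [hw, binomWeight.add_shift]; ring
      rw [sum_congr rfl this, sum_sub_distrib, ← mul_sum, ← o1, ← o2, h_succ]
      field_simp
      ring
    have o2 : ∑ i ∈ range (n + 1), 2 / (2 * (i : ℝ) + 1) * w (2 * i + 1) = h n := by
      rw [sum_range_succ, hz _ (by omega : n < 2 * n + 1), h_eq_sum_binomWeight n]; simp [hw]
    have o3 : ∑ i ∈ range (n + 1), 1 / ((i : ℝ) + 1) * w (2 * i + 2) = H n - h n := by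
      rw [sum_range_succ, hz _ (by omega : n < 2 * n + 2), H_sub_h_eq_sum_binomWeight n]; simp [hw]
    have o4 : ∑ i ∈ range (n + 1),
        (1 / (2 * (i : ℝ) + 1) + 1 / (2 * ((i + 1 : ℕ) : ℝ) + 1)) * w (2 * i + 2)
        = (n * h n + 1) / (n + 1) - 1 := by
      have := sum_range_sub (fun i : ℕ => 1 / (2 * (i : ℝ) + 1) * w (2 * i)) (n + 1)
      rw [hz _ (by omega : n < 2 * (n + 1))] at this
      have z : w (2 * 0) = 1 := binomWeight.zero_right n
      rw [z] at this
      have e1 : ∑ i ∈ range (n + 1),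
          (1 / (2 * (i : ℝ) + 1) + 1 / (2 * ((i + 1 : ℕ) : ℝ) + 1)) * w (2 * i + 2)
          = ∑ i ∈ range (n + 1), 1 / (2 * (i : ℝ) + 1) * (w (2 * i) + w (2 * i + 2))
            + ∑ i ∈ range (n + 1), (1 / (2 * ((i + 1 : ℕ) : ℝ) + 1) * w (2 * (i + 1))
              - 1 / (2 * (i : ℝ) + 1) * w (2 * i)) := by
        rw [← sum_add_distrib]
        refine sum_congr rfl fun i _ => ?_
        rw [show 2 * (i + 1) = 2 * i + 2 by ring]; ring
      rw [e1, o, this]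
      simp
      ring
    have s := sum_congr (rfl : range (n + 1) = _) t
    rw [sum_sub_distrib, ← e, ← sum_div, sum_add_distrib, sum_add_distrib, sum_add_distrib,
      sum_add_distrib,
      sum_range_sub' (fun i => 4 * h i * w (2 * i + 1) + (H (2 * i) + H (2 * i + 1)) * w (2 * i)),
      ← mul_sum, o2, o3, o4, hz _ (by omega : n < 2 * (n + 1) + 1),
      hz _ (by omega : n < 2 * (n + 1))] at s
    rw [sub_eq_iff_eq_add'] at s
    rw [sum_add_distrib, s, H_succ, h_succ, show w (2 * 0) = 1 from binomWeight.zero_right n]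
    have b1 : h 0 = 0 := by simp [h]
    have b2 : H (2 * 0) = 0 := by simp [H]
    have b3 : H (2 * 0 + 1) = 1 := by simp [H]
    rw [b1, b2, b3]
    field_simp
    ring

lemma hasSum_zeta {s : ℕ} (hs : 2 ≤ s) : HasSum (fun n : ℕ => (1 : ℝ) / ((n : ℝ) + 1) ^ s) (zeta s) := by
  have := (summable_nat_add_iff 1).2 (Real.summable_one_div_nat_pow.2 (by omega : 1 < s))
  refine Summable.hasSum ?_
  simpa using this

lemma HasSum.of_eq {ι : Type*} {f g : ι → ℝ} {a b : ℝ} (hf : HasSum f a) (hfg : ∀ n, f n = g n) (hab : a = b) :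
    HasSum g b := by
  rwa [← funext hfg, ← hab]

/-- If all terms of a double series are nonnegative, its two iterated sums agree. -/
lemma hasSum_comm_of_nonneg {f : ℕ → ℕ → ℝ} (hf : ∀ i j, 0 ≤ f i j) {a b : ℕ → ℝ} {s : ℝ}
    (ha : ∀ i, HasSum (f i) (a i)) (hb : ∀ j, HasSum (fun i => f i j) (b j)) (hs : HasSum b s) :
    HasSum a s := by
  have h1 : Summable (fun p : ℕ × ℕ => f p.2 p.1) := by
    rw [summable_prod_of_nonneg fun p => hf _ _]
    refine ⟨fun j => (hb j).summable, ?_⟩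
    simpa only [(hb _).tsum_eq] using hs.summable
  have h2 := h1.hasSum
  have h3 : ∑' p : ℕ × ℕ, f p.2 p.1 = s := (h2.prod_fiberwise hb).unique hs
  rw [h3] at h2
  exact ((Equiv.prodComm ℕ ℕ).hasSum_iff.2 h2).prod_fiberwise ha

lemma hasSum_comm_of_summable {f : ℕ → ℕ → ℝ} (hf : Summable fun p : ℕ × ℕ => f p.1 p.2)
    {a b : ℕ → ℝ} {s : ℝ} (ha : ∀ i, HasSum (f i) (a i)) (hb : ∀ j, HasSum (fun i => f i j) (b j))
    (hs : HasSum b s) : HasSum a s := by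
  have h2 := ((Equiv.prodComm ℕ ℕ).hasSum_iff.2 hf.hasSum).prod_fiberwise hb
  have h3 := hf.hasSum.prod_fiberwise ha
  rwa [h2.unique hs] at h3

lemma hasSum_of_tendsto {f : ℕ → ℝ} (hf : ∀ n, 0 ≤ f n) {s : ℝ}
    (hs : Tendsto (fun N => ∑ n ∈ range N, f n) atTop (𝓝 s)) : HasSum f s :=
  (hasSum_iff_tendsto_nat_of_nonneg hf s).2 hs

/-- Split off the odd-indexed part of a series vanishing at `0`. -/
lemma HasSum.odd_of_succ {f : ℕ → ℝ} (h0 : f 0 = 0) {s e : ℝ}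
    (hs : HasSum (fun n => f (n + 1)) s) (he : HasSum (fun n => f (2 * (n + 1))) e) :
    HasSum (fun n => f (2 * n + 1)) (s - e) := by
  have hs' : HasSum f s := by
    have := (hasSum_nat_add_iff 1).1 hs
    simpa [h0] using this
  have he' : HasSum (fun n => f (2 * n)) e := by
    have := (hasSum_nat_add_iff (f := fun n => f (2 * n)) 1).1 he
    simpa [h0] using this
  have ho : Summable fun n => f (2 * n + 1) :=
    hs'.summable.comp_injective (i := fun n => 2 * n + 1) fun a b hab => by simpa using hab
  have := (he'.even_add_odd ho.hasSum).unique hs'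
  have h2 := ho.hasSum
  rwa [show ∑' n, f (2 * n + 1) = s - e by linarith] at h2

lemma hasSum_odd_zeta {s : ℕ} (hs : 2 ≤ s) :
    HasSum (fun n : ℕ => (1 : ℝ) / (2 * (n : ℝ) + 1) ^ s) ((1 - 1 / 2 ^ s) * zeta s) := by
  have h1 := hasSum_zeta hs
  have h2 : HasSum (fun n : ℕ => (1 : ℝ) / (((2 * (n + 1) : ℕ)) : ℝ) ^ s) (1 / 2 ^ s * zeta s) := by
    refine (h1.mul_left (1 / 2 ^ s)).congr_fun ?_
    intro n
    push_cast
    rw [mul_pow]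
    field_simp
  have := HasSum.odd_of_succ (f := fun n => (1 : ℝ) / (n : ℝ) ^ s) (by simp; omega)
    (by simpa using h1) h2
  convert this using 1
  · simp
  · ring

lemma tendsto_H2 : Tendsto H2 atTop (𝓝 (zeta 2)) := (hasSum_zeta le_rfl).tendsto_sum_nat
lemma tendsto_H3 : Tendsto H3 atTop (𝓝 (zeta 3)) := (hasSum_zeta (by norm_num)).tendsto_sum_nat

lemma H_nonneg (n : ℕ) : 0 ≤ H n := sum_nonneg fun _ _ => by positivity
lemma H3_nonneg (n : ℕ) : 0 ≤ H3 n := sum_nonneg fun _ _ => by positivity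
lemma h_nonneg (n : ℕ) : 0 ≤ h n := sum_nonneg fun _ _ => by positivity

lemma H2_le (n : ℕ) : H2 n ≤ zeta 2 :=
  sum_le_hasSum _ (fun _ _ => by positivity) (hasSum_zeta le_rfl)
lemma zeta_sub_H2_le (n : ℕ) : zeta 2 - H2 (n + 1) ≤ 1 / ((n : ℝ) + 1) := by
  have key : ∀ m, H2 (n + 1 + m) ≤ H2 (n + 1) + 1 / ((n : ℝ) + 1) - 1 / ((n : ℝ) + 1 + m) := by
    intro m
    induction m with
    | zero => simp
    | succ m ih =>
      rw [← add_assoc, H2_succ]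
      push_cast
      have : 1 / ((n : ℝ) + 1 + m + 1) ^ 2 ≤ 1 / ((n : ℝ) + 1 + m) - 1 / ((n : ℝ) + 1 + (m + 1)) := by
        rw [div_sub_div _ _ (by positivity) (by positivity), div_le_div_iff₀ (by positivity)
          (by positivity)]
        have : (0 : ℝ) ≤ n + m := by positivity
        nlinarith
      linarith
  have h1 : Tendsto (fun m => H2 (n + 1 + m)) atTop (𝓝 (zeta 2)) := by
    simpa only [add_comm] using (tendsto_add_atTop_iff_nat (n + 1)).2 tendsto_H2
  have := le_of_tendsto' h1 fun m => (key m).trans (sub_le_self _ (by positivity))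
  linarith

lemma tendsto_H_div : Tendsto (fun n : ℕ => H n / n) atTop (𝓝 0) := by
  have := (tendsto_one_div_add_atTop_nhds_zero_nat (𝕜 := ℝ)).cesaro
  refine this.congr fun n => ?_
  rw [H, div_eq_inv_mul]

lemma tendsto_zeta_sub_H2_mul_H : Tendsto (fun n => (zeta 2 - H2 n) * H n) atTop (𝓝 0) := by
  refine squeeze_zero' (Eventually.of_forall fun n =>
    mul_nonneg (sub_nonneg.2 (H2_le n)) (H_nonneg n)) ?_ tendsto_H_div
  filter_upwards [eventually_gt_atTop 0] with n hn
  obtain ⟨m, rfl⟩ := Nat.exists_eq_succ_of_ne_zero hn.ne'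
  have := mul_le_mul_of_nonneg_right (zeta_sub_H2_le m) (H_nonneg (m + 1))
  push_cast
  rw [Nat.succ_eq_add_one]
  linarith [this, show 1 / ((m : ℝ) + 1) * H (m + 1) = H (m + 1) / (m + 1) by ring]

namespace binomWeight

lemma zero_left {k : ℕ} (hk : 0 < k) : binomWeight 0 k = 0 := eq_zero hk

/-- Summation by parts against the weights. -/
lemma sum_by_parts {k : ℕ} (hk : 0 < k) (C : ℕ → ℝ) (N : ℕ) :
    (k : ℝ) ^ 2 * ∑ n ∈ range N, binomWeight (n + 1) k * (C n / ((n : ℝ) + 1) ^ 2)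
      = binomWeight N k * C N + ∑ n ∈ range N, binomWeight (n + 1) k * (C n - C (n + 1)) := by
  induction N with
  | zero => simp [zero_left hk]
  | succ N ih =>
    rw [sum_range_succ, sum_range_succ, mul_add, ih]
    have := succ_left_sub N k
    linear_combination (-C N) * this

lemma hasSum_of_tendsto_parts {k : ℕ} (hk : 0 < k) {C : ℕ → ℝ} (hC : ∀ n, 0 ≤ C n) {t : ℝ}
    (ht : Tendsto (fun N => binomWeight N k * C N
      + ∑ n ∈ range N, binomWeight (n + 1) k * (C n - C (n + 1))) atTop (𝓝 t)) :
    HasSum (fun n => binomWeight (n + 1) k * (C n / ((n : ℝ) + 1) ^ 2)) (t / (k : ℝ) ^ 2) := by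
  refine hasSum_of_tendsto (fun n => mul_nonneg (nonneg _ _) (div_nonneg (hC n) (by positivity))) ?_
  have hk' : (k : ℝ) ≠ 0 := by positivity
  refine (ht.div_const ((k : ℝ) ^ 2)).congr fun N => ?_
  rw [← sum_by_parts hk]
  field_simp

lemma hasSum_one {k : ℕ} (hk : 0 < k) :
    HasSum (fun n : ℕ => binomWeight (n + 1) k * (1 / ((n : ℝ) + 1) ^ 2)) (1 / (k : ℝ) ^ 2) := by
  refine hasSum_of_tendsto_parts hk (C := fun _ => 1) (by simp) ?_
  simpa using tendsto_one k

lemma hasSum_zeta_sub_H2 {k : ℕ} (hk : 0 < k) :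
    HasSum (fun n : ℕ => binomWeight (n + 1) k * ((zeta 2 - H2 n) / ((n : ℝ) + 1) ^ 2))
      (1 / (k : ℝ) ^ 4) := by
  have := hasSum_of_tendsto_parts hk (C := fun n => zeta 2 - H2 n) (t := 1 / (k : ℝ) ^ 2)
    (fun n => sub_nonneg.2 (H2_le n)) ?_
  · convert this using 1
    field_simp
  · have h1 := (tendsto_one k).mul (tendsto_H2.const_sub (zeta 2))
    have h2 := (hasSum_one hk).tendsto_sum_nat
    have h3 := h1.add h2
    simp only [sub_self, mul_zero, zero_add] at h3
    refine h3.congr fun N => ?_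
    congr 1
    refine sum_congr rfl fun n _ => ?_
    rw [H2_succ]; ring

lemma sub_succ_div (n k : ℕ) :
    (binomWeight (n + 1) k - binomWeight (n + 1) (k + 1)) / ((n : ℝ) + 1)
      = k * (binomWeight (n + 1) k / ((n : ℝ) + 1) ^ 2)
        + (k + 1) * (binomWeight (n + 1) (k + 1) / ((n : ℝ) + 1) ^ 2) := by
  rw [succ_right]
  have h1 : (n : ℝ) + 1 ≠ 0 := by positivity
  have h2 : (n : ℝ) + 1 + k + 1 ≠ 0 := by positivity
  push_cast
  field_simp
  ring

lemma sub_succ (n k : ℕ) :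
    binomWeight n k - binomWeight n (k + 1) = binomWeight n k * ((2 * k + 1) / (n + (k + 1))) := by
  rw [succ_right]
  have h2 : (n : ℝ) + k + 1 ≠ 0 := by positivity
  have h3 : (n : ℝ) + (k + 1) ≠ 0 := by positivity
  field_simp
  ring

lemma sum_sub_succ_div (k N : ℕ) :
    ∑ n ∈ range N, (binomWeight (n + 1) k - binomWeight (n + 1) (k + 1)) / ((n : ℝ) + 1)
      = binomWeight N k / k + binomWeight N (k + 1) / (k + 1) := by
  have e : ∀ n ∈ range N, (binomWeight (n + 1) k - binomWeight (n + 1) (k + 1)) / ((n : ℝ) + 1)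
      = (binomWeight (n + 1) k / k + binomWeight (n + 1) (k + 1) / (k + 1))
        - (binomWeight n k / k + binomWeight n (k + 1) / (k + 1)) := by
    intro n _
    have h1 := succ_left_sub n k
    have h2 := succ_left_sub n (k + 1)
    push_cast at h2
    have h3 : (k : ℝ) + 1 ≠ 0 := by positivity
    rw [sub_succ_div, add_sub_add_comm, ← sub_div, ← sub_div, h1, h2]
    rcases eq_or_ne k 0 with rfl | hk
    · simp
    · have : (k : ℝ) ≠ 0 := by exact_mod_cast hk
      field_simp
  rw [sum_congr rfl e, sum_range_sub fun n => binomWeight n k / k + binomWeight n (k + 1) / (k + 1),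
    zero_left (Nat.succ_pos k)]
  rcases eq_or_ne k 0 with rfl | hk
  · simp
  · simp [zero_left (Nat.pos_of_ne_zero hk)]

end binomWeight

lemma H_eq_pred (k : ℕ) : H k = H (k - 1) + 1 / k := by
  cases k with
  | zero => simp [H]
  | succ k => simp [H_succ]

lemma H3_eq_pred (k : ℕ) : H3 k = H3 (k - 1) + 1 / (k : ℝ) ^ 3 := by
  cases k with
  | zero => simp [H3]
  | succ k => simp [H3_succ]

namespace binomWeight

lemma tendsto_mul_H_sub (k : ℕ) :
    Tendsto (fun N => binomWeight N k * H N - ∑ n ∈ range N, binomWeight (n + 1) k / ((n : ℝ) + 1))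
      atTop (𝓝 (H k + H (k - 1))) := by
  induction k with
  | zero =>
    simp [zero_right, H]
  | succ k ih =>
    have h1 : Tendsto (fun N => (binomWeight N k - binomWeight N (k + 1)) * H N) atTop (𝓝 0) := by
      have h0 := ((tendsto_one k).mul_const (2 * (k : ℝ) + 1)).mul tendsto_H_div
      rw [mul_zero] at h0
      refine squeeze_zero (fun N => ?_) (fun N => ?_) h0
      · rw [sub_succ]
        exact mul_nonneg (mul_nonneg (nonneg _ _) (by positivity)) (H_nonneg N)
      · rw [sub_succ]
        rcases Nat.eq_zero_or_pos N with rfl | hN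
        · simp [H]
        · have : (0 : ℝ) < N := by exact_mod_cast hN
          rw [mul_div_assoc', mul_div_assoc', div_mul_eq_mul_div]
          refine div_le_div_of_nonneg_left (mul_nonneg (mul_nonneg (nonneg _ _) (by positivity))
            (H_nonneg N)) this (by linarith [(k.cast_nonneg : (0 : ℝ) ≤ k)])
    have h2 := ((tendsto_one k).div_const (k : ℝ)).add ((tendsto_one (k + 1)).div_const ((k : ℝ) + 1))
    have h3 := (ih.add h2).sub h1
    have e : H k + H (k - 1) + (1 / (k : ℝ) + 1 / (k + 1)) - 0 = H (k + 1) + H (k + 1 - 1) := by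
      have := H_eq_pred k
      rw [H_succ, Nat.add_sub_cancel]
      linarith
    rw [e] at h3
    refine h3.congr fun N => ?_
    rw [← sum_sub_succ_div]
    have : ∑ n ∈ range N, (binomWeight (n + 1) k - binomWeight (n + 1) (k + 1)) / ((n : ℝ) + 1)
        = ∑ n ∈ range N, binomWeight (n + 1) k / ((n : ℝ) + 1)
          - ∑ n ∈ range N, binomWeight (n + 1) (k + 1) / ((n : ℝ) + 1) := by
      rw [← sum_sub_distrib]
      exact sum_congr rfl fun n _ => sub_div _ _ _
    rw [this]
    ring

lemma hasSum_H {k : ℕ} (hk : 0 < k) :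
    HasSum (fun n : ℕ => binomWeight (n + 1) k * (H n / ((n : ℝ) + 1) ^ 2))
      ((H k + H (k - 1)) / (k : ℝ) ^ 2) := by
  refine hasSum_of_tendsto_parts hk H_nonneg ((tendsto_mul_H_sub k).congr fun N => ?_)
  rw [sub_eq_add_neg, ← sum_neg_distrib]
  congr 1
  refine sum_congr rfl fun n _ => ?_
  rw [H_succ]; ring

/-- Series whose terms are `i`-combinations of the weights. -/
lemma hasSum_comm {c C G : ℕ → ℝ} {e : ℕ → ℕ} (hc : ∀ i, 0 ≤ c i) (he : ∀ i, i < e i)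
    (hC : ∀ n, 0 ≤ C n)
    (hG : ∀ i, HasSum (fun n : ℕ => binomWeight (n + 1) (e i) * (C n / ((n : ℝ) + 1) ^ 2)) (G i))
    {s : ℝ} (hs : HasSum (fun i => c i * G i) s) :
    HasSum (fun n : ℕ => (∑ i ∈ range (n + 1), c i * binomWeight (n + 1) (e i))
      * (C n / ((n : ℝ) + 1) ^ 2)) s := by
  refine hasSum_comm_of_nonneg
    (f := fun n i => c i * (binomWeight (n + 1) (e i) * (C n / ((n : ℝ) + 1) ^ 2)))
    (fun n i => mul_nonneg (hc i) (mul_nonneg (nonneg _ _) (div_nonneg (hC n) (by positivity))))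
    (fun n => ?_) (fun i => (hG i).mul_left (c i)) hs
  rw [sum_mul]
  simp only [← mul_assoc]
  refine hasSum_sum_of_ne_finset_zero fun i hi => ?_
  have : n + 1 ≤ i := by simpa using hi
  rw [eq_zero (this.trans_lt (he i))]
  simp

end binomWeight

lemma hasSum_h_div_sq :
    HasSum (fun n : ℕ => h (n + 1) / ((n : ℝ) + 1) ^ 2) (7 / 4 * zeta 3) := by
  have := binomWeight.hasSum_comm (c := fun i => 2 / (2 * (i : ℝ) + 1)) (C := fun _ => 1)
    (e := fun i => 2 * i + 1) (fun i => by positivity) (fun i => by omega) (by simp)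
    (fun i => binomWeight.hasSum_one (by omega)) (s := 7 / 4 * zeta 3) ?_
  · simp only [← h_eq_sum_binomWeight] at this
    simpa [div_eq_mul_inv] using this
  · have := (hasSum_odd_zeta (s := 3) (by norm_num)).mul_left 2
    refine this.of_eq (fun i => ?_) (by ring)
    push_cast
    field_simp

lemma hasSum_H_div_sq : HasSum (fun n : ℕ => H (n + 1) / ((n : ℝ) + 1) ^ 2) (2 * zeta 3) := by
  have := binomWeight.hasSum_comm (c := fun i => 1 / ((i : ℝ) + 1)) (C := fun _ => 1)
    (e := fun i => 2 * i + 2) (fun i => by positivity) (fun i => by omega) (by simp)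
    (fun i => binomWeight.hasSum_one (by omega)) (s := 1 / 4 * zeta 3) ?_
  · simp only [← H_sub_h_eq_sum_binomWeight] at this
    have := this.add hasSum_h_div_sq
    convert this using 1
    · ext n; ring
    · ring
  · have := (hasSum_zeta (s := 3) (by norm_num)).mul_left (1 / 4)
    refine this.of_eq (fun i => ?_) rfl
    push_cast
    rw [show 2 * (i : ℝ) + 2 = 2 * (i + 1) by ring]
    field_simp
    norm_num

namespace binomWeight

lemma hasSum_zeta_sub_H2_div (k : ℕ) :
    HasSum (fun n : ℕ => binomWeight (n + 1) k * ((zeta 2 - H2 n) / ((n : ℝ) + 1)))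
      (2 * zeta 3 - H3 k - H3 (k - 1)) := by
  induction k with
  | zero =>
    have h0 : HasSum (fun n : ℕ => (zeta 2 - H2 n) / ((n : ℝ) + 1)) (2 * zeta 3) := by
      refine hasSum_of_tendsto (fun n => div_nonneg (sub_nonneg.2 (H2_le n)) (by positivity)) ?_
      have := tendsto_zeta_sub_H2_mul_H.add hasSum_H_div_sq.tendsto_sum_nat
      rw [zero_add] at this
      refine this.congr fun N => ?_
      induction N with
      | zero => simp [H]
      | succ N ih =>
        rw [sum_range_succ, sum_range_succ, ← ih, H2_succ, H_succ]
        ring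
    simpa [zero_right, H3] using h0
  | succ k ih =>
    have h1 : HasSum (fun n : ℕ => (k : ℝ) * (binomWeight (n + 1) k
        * ((zeta 2 - H2 n) / ((n : ℝ) + 1) ^ 2))) (1 / (k : ℝ) ^ 3) := by
      rcases Nat.eq_zero_or_pos k with rfl | hk
      · simp
      · refine ((hasSum_zeta_sub_H2 hk).mul_left (k : ℝ)).of_eq (fun _ => rfl) ?_
        field_simp
    have h2 := (hasSum_zeta_sub_H2 (Nat.succ_pos k)).mul_left ((k : ℝ) + 1)
    have h3 := (ih.sub h1).sub h2
    refine h3.of_eq (fun n => ?_) ?_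
    · have := sub_succ_div n k
      have e : (n : ℝ) + 1 ≠ 0 := by positivity
      linear_combination (zeta 2 - H2 n) * this
    · have := H3_eq_pred k
      rw [H3_succ, Nat.add_sub_cancel]
      have e : (k : ℝ) + 1 ≠ 0 := by positivity
      rw [show ((k : ℝ) + 1) * (1 / ((k + 1 : ℕ) : ℝ) ^ 4) = 1 / ((k : ℝ) + 1) ^ 3 by
        push_cast; field_simp]
      linarith

lemma hasSum_H3_add {k : ℕ} (hk : 0 < k) :
    HasSum (fun n : ℕ => binomWeight (n + 1) k
        * ((H3 n + (zeta 2 - H2 n) * H n) / ((n : ℝ) + 1) ^ 2))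
      (((H k + H (k - 1)) / (k : ℝ) ^ 2 - zeta 3 + H3 k + H3 (k - 1)) / (k : ℝ) ^ 2) := by
  refine hasSum_of_tendsto_parts hk (C := fun n => H3 n + (zeta 2 - H2 n) * H n)
    (fun n => add_nonneg (H3_nonneg n) (mul_nonneg (sub_nonneg.2 (H2_le n)) (H_nonneg n))) ?_
  have h1 := (tendsto_one k).mul (tendsto_H3.add tendsto_zeta_sub_H2_mul_H)
  have h2 := ((hasSum_H hk).sub (hasSum_zeta_sub_H2_div k)).tendsto_sum_nat
  have h3 := h1.add h2
  rw [show 1 * (zeta 3 + 0) + ((H k + H (k - 1)) / (k : ℝ) ^ 2 - (2 * zeta 3 - H3 k - H3 (k - 1)))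
    = (H k + H (k - 1)) / (k : ℝ) ^ 2 - zeta 3 + H3 k + H3 (k - 1) by ring] at h3
  refine h3.congr fun N => ?_
  congr 1
  refine sum_congr rfl fun n _ => ?_
  rw [H_succ, H2_succ, H3_succ]
  have : (n : ℝ) + 1 ≠ 0 := by positivity
  field_simp
  ring

end binomWeight

/-- Generalised harmonic numbers. -/
noncomputable def harm (a n : ℕ) : ℝ := ∑ j ∈ range n, 1 / ((j : ℝ) + 1) ^ a

/-- Generalised harmonic numbers over odd denominators. -/
noncomputable def oddHarm (a n : ℕ) : ℝ := ∑ j ∈ range n, 1 / (2 * (j : ℝ) + 1) ^ a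

/-- The strict linear Euler sum of `harm a (n - 1) / n ^ q`. -/
noncomputable def eulerSum (a q : ℕ) : ℝ := ∑' n : ℕ, harm a n / ((n : ℝ) + 1) ^ q

/-- The linear Euler sum of `oddHarm a n / n ^ q`. -/
noncomputable def oddEulerSum (a q : ℕ) : ℝ := ∑' n : ℕ, oddHarm a (n + 1) / ((n : ℝ) + 1) ^ q

lemma harm_nonneg (a n : ℕ) : 0 ≤ harm a n := sum_nonneg fun _ _ => by positivity
lemma oddHarm_nonneg (a n : ℕ) : 0 ≤ oddHarm a n := sum_nonneg fun _ _ => by positivity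

lemma harm_one (n : ℕ) : harm 1 n = H n := by simp [harm, H]
lemma oddHarm_one (n : ℕ) : oddHarm 1 n = h n := by simp [oddHarm, h]
lemma oddHarm_succ (a n : ℕ) : oddHarm a (n + 1) = oddHarm a n + 1 / (2 * (n : ℝ) + 1) ^ a :=
  sum_range_succ _ _

lemma harm_le_H {a : ℕ} (ha : 1 ≤ a) (n : ℕ) : harm a n ≤ H n :=
  sum_le_sum fun j _ => one_div_le_one_div_of_le (by positivity)
    (le_self_pow₀ (by linarith [(j.cast_nonneg : (0 : ℝ) ≤ j)]) (by omega))

lemma oddHarm_le_h {a : ℕ} (ha : 1 ≤ a) (n : ℕ) : oddHarm a n ≤ h n :=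
  sum_le_sum fun j _ => one_div_le_one_div_of_le (by positivity)
    (le_self_pow₀ (by linarith [(j.cast_nonneg : (0 : ℝ) ≤ j)]) (by omega))

lemma hasSum_eulerSum {a q : ℕ} (ha : 1 ≤ a) (hq : 2 ≤ q) :
    HasSum (fun n : ℕ => harm a n / ((n : ℝ) + 1) ^ q) (eulerSum a q) := by
  refine (Summable.of_nonneg_of_le (fun n => div_nonneg (harm_nonneg _ _) (by positivity))
    (fun n => ?_) hasSum_H_div_sq.summable).hasSum
  refine div_le_div₀ (H_nonneg _) ((harm_le_H ha n).trans ?_) (by positivity)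
    (pow_le_pow_right₀ (by linarith [(n.cast_nonneg : (0 : ℝ) ≤ n)]) hq)
  rw [H_succ]
  have : (0 : ℝ) ≤ 1 / ((n : ℝ) + 1) := by positivity
  linarith

lemma hasSum_eulerSum_succ {a q : ℕ} (ha : 1 ≤ a) (hq : 2 ≤ q) :
    HasSum (fun n : ℕ => harm a (n + 1) / ((n : ℝ) + 2) ^ q) (eulerSum a q) := by
  have := (hasSum_nat_add_iff' 1).2 (hasSum_eulerSum ha hq)
  refine this.of_eq (fun n => ?_) (by simp [harm])
  push_cast
  rw [add_assoc]
  norm_num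

lemma hasSum_oddEulerSum {a q : ℕ} (ha : 1 ≤ a) (hq : 2 ≤ q) :
    HasSum (fun n : ℕ => oddHarm a (n + 1) / ((n : ℝ) + 1) ^ q) (oddEulerSum a q) := by
  refine (Summable.of_nonneg_of_le (fun n => div_nonneg (oddHarm_nonneg _ _) (by positivity))
    (fun n => ?_) hasSum_h_div_sq.summable).hasSum
  exact div_le_div₀ (h_nonneg _) (oddHarm_le_h ha _) (by positivity)
    (pow_le_pow_right₀ (by linarith [(n.cast_nonneg : (0 : ℝ) ≤ n)]) hq)

lemma stuffle {a b : ℕ} (ha : 2 ≤ a) (hb : 2 ≤ b) :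
    zeta a * zeta b = eulerSum a b + eulerSum b a + zeta (a + b) := by
  have h1 := (((hasSum_eulerSum (by omega : 1 ≤ a) hb).add (hasSum_eulerSum (by omega : 1 ≤ b) ha)).add
    (hasSum_zeta (by omega : 2 ≤ a + b))).tendsto_sum_nat
  have h2 := (hasSum_zeta ha).tendsto_sum_nat.mul (hasSum_zeta hb).tendsto_sum_nat
  refine tendsto_nhds_unique (h2.congr fun N => ?_) h1
  induction N with
  | zero => simp
  | succ N ih =>
    rw [sum_range_succ, sum_range_succ, sum_range_succ, ← ih, harm, harm, pow_add]
    ring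

lemma HasSum.sum_antidiagonal_mul {f g : ℕ → ℝ} (hf0 : ∀ n, 0 ≤ f n) (hg0 : ∀ n, 0 ≤ g n)
    {s t : ℝ} (hf : HasSum f s) (hg : HasSum g t) :
    HasSum (fun n => ∑ p ∈ antidiagonal n, f p.1 * g p.2) (s * t) := by
  have hfg := hf.summable.mul_of_nonneg hg.summable hf0 hg0
  have h1 := (summable_sum_mul_antidiagonal_of_summable_mul hfg).hasSum
  rwa [← hf.summable.tsum_mul_tsum_eq_tsum_sum_antidiagonal hg.summable hfg, hf.tsum_eq,
    hg.tsum_eq] at h1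

lemma sum_antidiagonal_fst (f : ℕ → ℝ) (n : ℕ) :
    ∑ p ∈ antidiagonal n, f p.1 = ∑ i ∈ range (n + 1), f i :=
  Nat.sum_antidiagonal_eq_sum_range_succ (fun i _ => f i) n

lemma sum_antidiagonal_snd (f : ℕ → ℝ) (n : ℕ) :
    ∑ p ∈ antidiagonal n, f p.2 = ∑ i ∈ range (n + 1), f i := by
  rw [← sum_antidiagonal_fst, ← Nat.sum_antidiagonal_swap]
  rfl

section Shuffle

variable {u s : ℕ → ℝ}

lemma sum_antidiagonal_two_two (hu : ∀ i, 0 < u i) (hs : ∀ i j, u i + u j = s (i + j)) (n : ℕ) :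
    ∑ p ∈ antidiagonal n, 1 / u p.1 ^ 2 * (1 / u p.2 ^ 2)
      = 2 / s n ^ 2 * ∑ i ∈ range (n + 1), 1 / u i ^ 2
        + 4 / s n ^ 3 * ∑ i ∈ range (n + 1), 1 / u i ^ 1 := by
  have e : ∀ p ∈ antidiagonal n, 1 / u p.1 ^ 2 * (1 / u p.2 ^ 2)
      = 1 / s n ^ 2 * (1 / u p.1 ^ 2) + 1 / s n ^ 2 * (1 / u p.2 ^ 2)
        + 2 / s n ^ 3 * (1 / u p.1 ^ 1) + 2 / s n ^ 3 * (1 / u p.2 ^ 1) := by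
    intro p hp
    rw [← mem_antidiagonal.1 hp, ← hs]
    have h1 := (hu p.1).ne'
    have h2 := (hu p.2).ne'
    have h3 := (add_pos (hu p.1) (hu p.2)).ne'
    field_simp
    ring
  rw [sum_congr rfl e]
  simp only [sum_add_distrib, ← mul_sum]
  rw [sum_antidiagonal_fst fun i => 1 / u i ^ 2, sum_antidiagonal_snd fun i => 1 / u i ^ 2,
    sum_antidiagonal_fst fun i => 1 / u i ^ 1, sum_antidiagonal_snd fun i => 1 / u i ^ 1]
  ring

lemma sum_antidiagonal_three_three (hu : ∀ i, 0 < u i) (hs : ∀ i j, u i + u j = s (i + j))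
    (n : ℕ) :
    ∑ p ∈ antidiagonal n, 1 / u p.1 ^ 3 * (1 / u p.2 ^ 3)
      = 2 / s n ^ 3 * ∑ i ∈ range (n + 1), 1 / u i ^ 3
        + 6 / s n ^ 4 * ∑ i ∈ range (n + 1), 1 / u i ^ 2
        + 12 / s n ^ 5 * ∑ i ∈ range (n + 1), 1 / u i ^ 1 := by
  have e : ∀ p ∈ antidiagonal n, 1 / u p.1 ^ 3 * (1 / u p.2 ^ 3)
      = 1 / s n ^ 3 * (1 / u p.1 ^ 3) + 1 / s n ^ 3 * (1 / u p.2 ^ 3)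
        + 3 / s n ^ 4 * (1 / u p.1 ^ 2) + 3 / s n ^ 4 * (1 / u p.2 ^ 2)
        + 6 / s n ^ 5 * (1 / u p.1 ^ 1) + 6 / s n ^ 5 * (1 / u p.2 ^ 1) := by
    intro p hp
    rw [← mem_antidiagonal.1 hp, ← hs]
    have h1 := (hu p.1).ne'
    have h2 := (hu p.2).ne'
    have h3 := (add_pos (hu p.1) (hu p.2)).ne'
    field_simp
    ring
  rw [sum_congr rfl e]
  simp only [sum_add_distrib, ← mul_sum]
  rw [sum_antidiagonal_fst fun i => 1 / u i ^ 2, sum_antidiagonal_snd fun i => 1 / u i ^ 2,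
    sum_antidiagonal_fst fun i => 1 / u i ^ 3, sum_antidiagonal_snd fun i => 1 / u i ^ 3,
    sum_antidiagonal_fst fun i => 1 / u i ^ 1, sum_antidiagonal_snd fun i => 1 / u i ^ 1]
  ring

lemma sum_antidiagonal_two_four (hu : ∀ i, 0 < u i) (hs : ∀ i j, u i + u j = s (i + j)) (n : ℕ) :
    ∑ p ∈ antidiagonal n, 1 / u p.1 ^ 2 * (1 / u p.2 ^ 4)
      = 1 / s n ^ 2 * ∑ i ∈ range (n + 1), 1 / u i ^ 4
        + 2 / s n ^ 3 * ∑ i ∈ range (n + 1), 1 / u i ^ 3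
        + 4 / s n ^ 4 * ∑ i ∈ range (n + 1), 1 / u i ^ 2
        + 8 / s n ^ 5 * ∑ i ∈ range (n + 1), 1 / u i ^ 1 := by
  have e : ∀ p ∈ antidiagonal n, 1 / u p.1 ^ 2 * (1 / u p.2 ^ 4)
      = 1 / s n ^ 4 * (1 / u p.1 ^ 2) + 4 / s n ^ 5 * (1 / u p.1 ^ 1)
        + 1 / s n ^ 2 * (1 / u p.2 ^ 4) + 2 / s n ^ 3 * (1 / u p.2 ^ 3)
        + 3 / s n ^ 4 * (1 / u p.2 ^ 2) + 4 / s n ^ 5 * (1 / u p.2 ^ 1) := by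
    intro p hp
    rw [← mem_antidiagonal.1 hp, ← hs]
    have h1 := (hu p.1).ne'
    have h2 := (hu p.2).ne'
    have h3 := (add_pos (hu p.1) (hu p.2)).ne'
    field_simp
    ring
  rw [sum_congr rfl e]
  simp only [sum_add_distrib, ← mul_sum]
  rw [sum_antidiagonal_fst fun i => 1 / u i ^ 2, sum_antidiagonal_snd fun i => 1 / u i ^ 2,
    sum_antidiagonal_snd fun i => 1 / u i ^ 3, sum_antidiagonal_snd fun i => 1 / u i ^ 4,
    sum_antidiagonal_fst fun i => 1 / u i ^ 1, sum_antidiagonal_snd fun i => 1 / u i ^ 1]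
  ring

end Shuffle

lemma shuffle_two_two : zeta 2 ^ 2 = 2 * eulerSum 2 2 + 4 * eulerSum 1 3 := by
  have h0 := hasSum_zeta (le_refl 2)
  have h1 := h0.sum_antidiagonal_mul (fun n => by positivity) (fun n => by positivity) h0
  have h2 := ((hasSum_eulerSum_succ (a := 2) (q := 2) (by norm_num) (by norm_num)).mul_left 2).add
    ((hasSum_eulerSum_succ (a := 1) (q := 3) (by norm_num) (by norm_num)).mul_left 4)
  rw [sq]
  refine h1.unique (h2.of_eq (fun n => ?_) rfl)
  rw [sum_antidiagonal_two_two (u := fun i => (i : ℝ) + 1) (s := fun n => (n : ℝ) + 2)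
    (fun i => by positivity) (fun i j => by push_cast; ring), harm, harm]
  ring

lemma shuffle_three_three :
    zeta 3 ^ 2 = 2 * eulerSum 3 3 + 6 * eulerSum 2 4 + 12 * eulerSum 1 5 := by
  have h0 := hasSum_zeta (s := 3) (by norm_num)
  have h1 := h0.sum_antidiagonal_mul (fun n => by positivity) (fun n => by positivity) h0
  have h2 := (((hasSum_eulerSum_succ (a := 3) (q := 3) (by norm_num) (by norm_num)).mul_left 2).add
    ((hasSum_eulerSum_succ (a := 2) (q := 4) (by norm_num) (by norm_num)).mul_left 6)).add
    ((hasSum_eulerSum_succ (a := 1) (q := 5) (by norm_num) (by norm_num)).mul_left 12)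
  rw [sq]
  refine h1.unique (h2.of_eq (fun n => ?_) rfl)
  rw [sum_antidiagonal_three_three (u := fun i => (i : ℝ) + 1) (s := fun n => (n : ℝ) + 2)
    (fun i => by positivity) (fun i j => by push_cast; ring), harm, harm, harm]
  ring

lemma shuffle_two_four :
    zeta 2 * zeta 4
      = eulerSum 4 2 + 2 * eulerSum 3 3 + 4 * eulerSum 2 4 + 8 * eulerSum 1 5 := by
  have h1 := (hasSum_zeta (le_refl 2)).sum_antidiagonal_mul (fun n => by positivity)
    (fun n => by positivity) (hasSum_zeta (s := 4) (by norm_num))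
  have h2 := (((hasSum_eulerSum_succ (a := 4) (q := 2) (by norm_num) (by norm_num)).add
    ((hasSum_eulerSum_succ (a := 3) (q := 3) (by norm_num) (by norm_num)).mul_left 2)).add
    ((hasSum_eulerSum_succ (a := 2) (q := 4) (by norm_num) (by norm_num)).mul_left 4)).add
    ((hasSum_eulerSum_succ (a := 1) (q := 5) (by norm_num) (by norm_num)).mul_left 8)
  refine h1.unique (h2.of_eq (fun n => ?_) rfl)
  rw [sum_antidiagonal_two_four (u := fun i => (i : ℝ) + 1) (s := fun n => (n : ℝ) + 2)
    (fun i => by positivity) (fun i j => by push_cast; ring), harm, harm, harm, harm]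
  ring

lemma odd_shuffle_two_two :
    oddEulerSum 2 2 + oddEulerSum 1 3 = 9 / 8 * zeta 2 ^ 2 := by
  have h0 := hasSum_odd_zeta (le_refl 2)
  have h1 := h0.sum_antidiagonal_mul (fun n => by positivity) (fun n => by positivity) h0
  have h2 := ((hasSum_oddEulerSum (a := 2) (q := 2) (by norm_num) (by norm_num)).add
    (hasSum_oddEulerSum (a := 1) (q := 3) (by norm_num) (by norm_num))).div_const 2
  have := h1.unique (h2.of_eq (fun n => ?_) rfl)
  · linear_combination (-2) * this
  rw [sum_antidiagonal_two_two (u := fun i => 2 * (i : ℝ) + 1) (s := fun n => 2 * ((n : ℝ) + 1))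
    (fun i => by positivity) (fun i j => by push_cast; ring), oddHarm, oddHarm]
  field_simp
  ring

lemma odd_shuffle_three_three :
    2 * oddEulerSum 3 3 + 3 * oddEulerSum 2 4 + 3 * oddEulerSum 1 5 = 49 / 8 * zeta 3 ^ 2 := by
  have h0 := hasSum_odd_zeta (s := 3) (by norm_num)
  have h1 := h0.sum_antidiagonal_mul (fun n => by positivity) (fun n => by positivity) h0
  have h2 := ((((hasSum_oddEulerSum (a := 3) (q := 3) (by norm_num) (by norm_num)).mul_left 2).add
    ((hasSum_oddEulerSum (a := 2) (q := 4) (by norm_num) (by norm_num)).mul_left 3)).add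
    ((hasSum_oddEulerSum (a := 1) (q := 5) (by norm_num) (by norm_num)).mul_left 3)).div_const 8
  have := h1.unique (h2.of_eq (fun n => ?_) rfl)
  · linear_combination (-8) * this
  rw [sum_antidiagonal_three_three (u := fun i => 2 * (i : ℝ) + 1)
    (s := fun n => 2 * ((n : ℝ) + 1)) (fun i => by positivity) (fun i j => by push_cast; ring),
    oddHarm, oddHarm, oddHarm]
  field_simp
  ring

lemma odd_shuffle_two_four :
    oddEulerSum 2 4 + oddEulerSum 1 5 + oddEulerSum 3 3 + oddEulerSum 4 2
      = 45 / 16 * (zeta 2 * zeta 4) := by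
  have h1 := (hasSum_odd_zeta (le_refl 2)).sum_antidiagonal_mul (fun n => by positivity)
    (fun n => by positivity) (hasSum_odd_zeta (s := 4) (by norm_num))
  have h2 := ((((hasSum_oddEulerSum (a := 2) (q := 4) (by norm_num) (by norm_num)).add
    (hasSum_oddEulerSum (a := 1) (q := 5) (by norm_num) (by norm_num))).add
    (hasSum_oddEulerSum (a := 3) (q := 3) (by norm_num) (by norm_num))).add
    (hasSum_oddEulerSum (a := 4) (q := 2) (by norm_num) (by norm_num))).div_const 4
  have := h1.unique (h2.of_eq (fun n => ?_) rfl)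
  · linear_combination (-4) * this
  rw [sum_antidiagonal_two_four (u := fun i => 2 * (i : ℝ) + 1)
    (s := fun n => 2 * ((n : ℝ) + 1)) (fun i => by positivity) (fun i j => by push_cast; ring),
    oddHarm, oddHarm, oddHarm, oddHarm]
  field_simp
  ring

lemma zeta_eq_of_hasSum {s : ℕ} (hs : 2 ≤ s) {x : ℝ}
    (hx : HasSum (fun n : ℕ => (1 : ℝ) / (n : ℝ) ^ s) x) : zeta s = x := by
  have := (hasSum_nat_add_iff' 1).2 hx
  refine (hasSum_zeta hs).unique (this.of_eq (fun n => by push_cast; rfl) ?_)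
  simp
  omega

lemma zeta_two : zeta 2 = π ^ 2 / 6 := zeta_eq_of_hasSum le_rfl hasSum_zeta_two

lemma zeta_four : zeta 4 = π ^ 4 / 90 := zeta_eq_of_hasSum (by norm_num) hasSum_zeta_four

lemma zeta_six : zeta 6 = π ^ 6 / 945 := by
  refine zeta_eq_of_hasSum (by norm_num) ?_
  refine (hasSum_zeta_nat (k := 3) (by norm_num)).of_eq (fun n => by norm_num) ?_
  have b5 : bernoulli' 5 = 0 := by
    rw [bernoulli'_def]
    norm_num [sum_range_succ, Nat.choose, bernoulli'_four, bernoulli'_three, bernoulli'_two]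
  have b6 : bernoulli 6 = 1 / 42 := by
    rw [bernoulli_eq_bernoulli'_of_ne_one (by norm_num), bernoulli'_def]
    norm_num [sum_range_succ, Nat.choose, b5, bernoulli'_four, bernoulli'_three, bernoulli'_two]
  norm_num [b6, Nat.factorial]
  ring

lemma eulerSum_one_three : eulerSum 1 3 = zeta 4 / 4 := by
  linarith [shuffle_two_two, stuffle (le_refl 2) (le_refl 2)]

lemma eulerSum_three_three : eulerSum 3 3 = (zeta 3 ^ 2 - zeta 6) / 2 := by
  linarith [stuffle (a := 3) (b := 3) (by norm_num) (by norm_num)]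

lemma eulerSum_one_five : eulerSum 1 5 = 3 / 4 * zeta 6 - zeta 3 ^ 2 / 2 := by
  linarith [shuffle_three_three, shuffle_two_four, eulerSum_three_three,
    stuffle (a := 2) (b := 4) (by norm_num) (by norm_num)]

lemma harm_three (n : ℕ) : harm 3 n = H3 n := rfl

lemma hasSum_h_div {q : ℕ} (hq : 2 ≤ q) :
    HasSum (fun n : ℕ => h (n + 1) / ((n : ℝ) + 1) ^ q) (oddEulerSum 1 q) := by
  simpa only [oddHarm_one] using hasSum_oddEulerSum le_rfl hq

lemma hasSum_H_div {q : ℕ} (hq : 2 ≤ q) :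
    HasSum (fun n : ℕ => H (n + 1) / ((n : ℝ) + 1) ^ q) (eulerSum 1 q + zeta (q + 1)) := by
  refine ((hasSum_eulerSum le_rfl hq).add (hasSum_zeta (by omega : 2 ≤ q + 1))).of_eq
    (fun n => ?_) rfl
  rw [harm_one, H_succ, pow_succ]
  field_simp

lemma H_two_mul (n : ℕ) : H (2 * n) = H n / 2 + h n := by
  induction n with
  | zero => simp [H, h]
  | succ n ih =>
    rw [show 2 * (n + 1) = 2 * n + 1 + 1 by ring, H_succ, H_succ, ih, H_succ, h_succ]
    push_cast
    rw [show 2 * (n : ℝ) + 1 + 1 = 2 * (n + 1) by ring]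
    field_simp
    ring

lemma H3_two_mul (n : ℕ) : H3 (2 * n) = H3 n / 8 + oddHarm 3 n := by
  induction n with
  | zero => simp [H3, oddHarm]
  | succ n ih =>
    rw [show 2 * (n + 1) = 2 * n + 1 + 1 by ring, H3_succ, H3_succ, ih, H3_succ, oddHarm_succ]
    push_cast
    rw [show 2 * (n : ℝ) + 1 + 1 = 2 * (n + 1) by ring]
    field_simp
    ring

/-- The part over odd `k` of the Euler sum of `(H k + H (k - 1)) / k ^ q`. -/
lemma hasSum_odd_H_add_H {q : ℕ} (hq : 2 ≤ q) :
    HasSum (fun i : ℕ => (H (2 * i + 1) + H (2 * i)) / (2 * (i : ℝ) + 1) ^ q)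
      (2 * eulerSum 1 q + zeta (q + 1)
        - (eulerSum 1 q + zeta (q + 1) / 2 + 2 * oddEulerSum 1 q) / 2 ^ q) := by
  have h1 : HasSum (fun n : ℕ => (H (n + 1) + H n) / (((n + 1 : ℕ)) : ℝ) ^ q)
      (2 * eulerSum 1 q + zeta (q + 1)) := by
    refine ((hasSum_H_div hq).add (hasSum_eulerSum le_rfl hq)).of_eq (fun n => ?_) (by ring)
    rw [harm_one]
    push_cast
    ring
  have h2 : HasSum (fun n : ℕ => (H (2 * (n + 1)) + H (2 * (n + 1) - 1)) /
      ((2 * (n + 1) : ℕ) : ℝ) ^ q)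
      ((eulerSum 1 q + zeta (q + 1) / 2 + 2 * oddEulerSum 1 q) / 2 ^ q) := by
    refine ((((hasSum_H_div hq).add ((hasSum_h_div hq).mul_left 2)).sub
      ((hasSum_zeta (by omega : 2 ≤ q + 1)).div_const 2)).div_const (2 ^ q)).of_eq
      (fun n => ?_) (by ring)
    have e := H_eq_pred (2 * (n + 1))
    have e2 : H (2 * (n + 1) - 1) = H (n + 1) / 2 + h (n + 1) - 1 / (2 * ((n : ℝ) + 1)) := by
      rw [← H_two_mul, e]; push_cast; ring
    rw [e2, H_two_mul, pow_succ]
    push_cast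
    rw [mul_pow]
    field_simp
    ring
  have := HasSum.odd_of_succ (f := fun k : ℕ => (H k + H (k - 1)) / (k : ℝ) ^ q) (by simp [H])
    h1 h2
  refine this.of_eq (fun i => ?_) rfl
  push_cast
  rfl

lemma hasSum_odd_H_cube :
    HasSum (fun i : ℕ => (H (2 * i + 1) + H (2 * i)) / (2 * (i : ℝ) + 1) ^ 3)
      (45 / 32 * zeta 4 - 1 / 4 * oddEulerSum 1 3) :=
  (hasSum_odd_H_add_H (q := 3) (by norm_num)).of_eq (fun _ => rfl) (by
    rw [eulerSum_one_three]; ring)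

lemma hasSum_odd_H_pow_five :
    HasSum (fun i : ℕ => (H (2 * i + 1) + H (2 * i)) / (2 * (i : ℝ) + 1) ^ 5)
      (315 / 128 * zeta 6 - 63 / 64 * zeta 3 ^ 2 - 1 / 16 * oddEulerSum 1 5) :=
  (hasSum_odd_H_add_H (q := 5) (by norm_num)).of_eq (fun _ => rfl) (by
    rw [eulerSum_one_five]; ring)

lemma hasSum_odd_H3_cube :
    HasSum (fun i : ℕ => (H3 (2 * i + 1) + H3 (2 * i) - zeta 3) / (2 * (i : ℝ) + 1) ^ 3)
      (7 / 64 * zeta 3 ^ 2 - 1 / 4 * oddEulerSum 3 3) := by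
  have hJ : HasSum (fun n : ℕ => H3 n / ((n : ℝ) + 1) ^ 3) ((zeta 3 ^ 2 - zeta 6) / 2) := by
    simpa only [harm_three, eulerSum_three_three] using
      hasSum_eulerSum (a := 3) (q := 3) (by norm_num) (by norm_num)
  have hz3 := hasSum_zeta (s := 3) (by norm_num)
  have hz6 := hasSum_zeta (s := 6) (by norm_num)
  have h1 : HasSum (fun n : ℕ => (H3 (n + 1) + H3 n - zeta 3) / (((n + 1 : ℕ)) : ℝ) ^ 3) 0 := by
    refine (((hJ.mul_left 2).add hz6).sub (hz3.mul_left (zeta 3))).of_eq (fun n => ?_) (by ring)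
    rw [H3_succ]
    push_cast
    field_simp
    ring
  have h2 : HasSum (fun n : ℕ => (H3 (2 * (n + 1)) + H3 (2 * (n + 1) - 1) - zeta 3) /
      ((2 * (n + 1) : ℕ) : ℝ) ^ 3) (1 / 4 * oddEulerSum 3 3 - 7 / 64 * zeta 3 ^ 2) := by
    refine (((((hJ.add hz6).div_const 4).add
      ((hasSum_oddEulerSum (a := 3) (q := 3) (by norm_num) (by norm_num)).mul_left 2)).sub
      ((hz6.div_const 8).add (hz3.mul_left (zeta 3)))).div_const 8).of_eq
      (fun n => ?_) (by ring)
    have e := H3_eq_pred (2 * (n + 1))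
    have e2 : H3 (2 * (n + 1) - 1)
        = H3 (n + 1) / 8 + oddHarm 3 (n + 1) - 1 / (8 * ((n : ℝ) + 1) ^ 3) := by
      rw [← H3_two_mul, e]; push_cast; ring
    rw [e2, H3_two_mul, H3_succ]
    push_cast
    field_simp
    ring
  have := HasSum.odd_of_succ (f := fun k : ℕ => (H3 k + H3 (k - 1) - zeta 3) / (k : ℝ) ^ 3) (by simp)
    h1 h2
  refine this.of_eq (fun i => ?_) (by ring)
  push_cast
  rfl

lemma hasSum_H_mul_h_mul {C G : ℕ → ℝ} (hC : ∀ n, 0 ≤ C n)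
    (hG : ∀ k, 0 < k →
      HasSum (fun n : ℕ => binomWeight (n + 1) k * (C n / ((n : ℝ) + 1) ^ 2)) (G k)) {s t : ℝ}
    (hs : HasSum (fun i : ℕ => 4 * h (i + 1) / ((i : ℝ) + 1) * G (2 * i + 2)) s)
    (ht : HasSum (fun i : ℕ => 2 * (H (2 * i) + H (2 * i + 1)) / (2 * (i : ℝ) + 1)
      * G (2 * i + 1)) t) :
    HasSum (fun n : ℕ => H (n + 1) * h (n + 1) * (C n / ((n : ℝ) + 1) ^ 2)) (s + t) := by
  have h1 := binomWeight.hasSum_comm (e := fun i => 2 * i + 2)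
    (c := fun i : ℕ => 4 * h (i + 1) / ((i : ℝ) + 1)) (fun i =>
      div_nonneg (mul_nonneg (by norm_num) (h_nonneg _)) (by positivity)) (fun i => by omega) hC
    (fun i => hG _ (by omega)) hs
  have h2 := binomWeight.hasSum_comm (e := fun i => 2 * i + 1)
    (c := fun i : ℕ => 2 * (H (2 * i) + H (2 * i + 1)) / (2 * (i : ℝ) + 1)) (fun i =>
      div_nonneg (mul_nonneg (by norm_num) (add_nonneg (H_nonneg _) (H_nonneg _))) (by positivity))
    (fun i => by omega) hC (fun i => hG _ (by omega)) ht
  refine (h1.add h2).of_eq (fun n => ?_) rfl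
  rw [H_mul_h_eq_sum_binomWeight, sum_add_distrib]
  ring

lemma hasSum_H_mul_h :
    HasSum (fun n : ℕ => H (n + 1) * h (n + 1) / ((n : ℝ) + 1) ^ 2)
      (45 / 16 * zeta 4 + 1 / 2 * oddEulerSum 1 3) := by
  refine (hasSum_H_mul_h_mul (C := fun _ => 1) (by simp) (fun k hk => binomWeight.hasSum_one hk)
    (s := oddEulerSum 1 3) (t := 2 * (45 / 32 * zeta 4 - 1 / 4 * oddEulerSum 1 3))
    ?_ ?_).of_eq (fun n => by ring) (by ring)
  · refine (hasSum_h_div (q := 3) (by norm_num)).of_eq (fun i => ?_) rfl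
    push_cast
    rw [show 2 * (i : ℝ) + 2 = 2 * (i + 1) by ring]
    field_simp
    norm_num
  · refine (hasSum_odd_H_cube.mul_left 2).of_eq (fun i => ?_) rfl
    push_cast
    field_simp
    ring

lemma hasSum_zeta_sub_H2_mul_H_mul_h :
    HasSum (fun n : ℕ => H (n + 1) * h (n + 1) * ((zeta 2 - H2 n) / ((n : ℝ) + 1) ^ 2))
      (315 / 64 * zeta 6 - 63 / 32 * zeta 3 ^ 2 + 1 / 8 * oddEulerSum 1 5) := by
  refine (hasSum_H_mul_h_mul (fun n => sub_nonneg.2 (H2_le n))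
    (fun k hk => binomWeight.hasSum_zeta_sub_H2 hk)
    (s := 1 / 4 * oddEulerSum 1 5)
    (t := 2 * (315 / 128 * zeta 6 - 63 / 64 * zeta 3 ^ 2 - 1 / 16 * oddEulerSum 1 5))
    ?_ ?_).of_eq (fun n => by ring) (by ring)
  · refine ((hasSum_h_div (q := 5) (by norm_num)).mul_left (1 / 4)).of_eq (fun i => ?_) rfl
    push_cast
    rw [show 2 * (i : ℝ) + 2 = 2 * (i + 1) by ring]
    field_simp
    ring
  · refine (hasSum_odd_H_pow_five.mul_left 2).of_eq (fun i => ?_) rfl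
    push_cast
    field_simp
    ring

lemma hasSum_h_mul_H3_add :
    HasSum (fun n : ℕ => h (n + 1) * ((H3 n + (zeta 2 - H2 n) * H n) / ((n : ℝ) + 1) ^ 2))
      (315 / 64 * zeta 6 - 7 / 4 * zeta 3 ^ 2 - 1 / 8 * oddEulerSum 1 5
        - 1 / 2 * oddEulerSum 3 3) := by
  have := binomWeight.hasSum_comm (c := fun i => 2 / (2 * (i : ℝ) + 1))
    (C := fun n => H3 n + (zeta 2 - H2 n) * H n)
    (e := fun i => 2 * i + 1) (fun i => by positivity) (fun i => by omega)
    (fun n => add_nonneg (H3_nonneg n) (mul_nonneg (sub_nonneg.2 (H2_le n)) (H_nonneg n)))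
    (fun i => binomWeight.hasSum_H3_add (by omega)) (s := 315 / 64 * zeta 6 - 7 / 4 * zeta 3 ^ 2
      - 1 / 8 * oddEulerSum 1 5 - 1 / 2 * oddEulerSum 3 3) ?_
  · simpa only [← h_eq_sum_binomWeight] using this
  · refine ((hasSum_odd_H_pow_five.mul_left 2).add (hasSum_odd_H3_cube.mul_left 2)).of_eq
      (fun i => ?_) (by ring)
    simp only [Nat.add_sub_cancel]
    push_cast
    field_simp
    ring

/-- The value of the mixed tail sum that follows from the weight expansions. -/
lemma hasSum_h_mul_tails :
    HasSum (fun n : ℕ => h (n + 1) * ((zeta 3 - H3 (n + 1)) / ((n : ℝ) + 1) ^ 2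
        + (zeta 2 - H2 (n + 1)) / ((n : ℝ) + 1) ^ 3))
      (49 / 32 * zeta 3 ^ 2 - 7 / 4 * oddEulerSum 1 5 + 1 / 2 * oddEulerSum 3 3) := by
  refine (((hasSum_h_div_sq.mul_left (zeta 3)).sub
    (hasSum_h_mul_H3_add.sub hasSum_zeta_sub_H2_mul_H_mul_h)).sub
    ((hasSum_h_div (q := 5) (by norm_num)).mul_left 2)).of_eq (fun n => ?_) (by ring)
  rw [H3_succ, H2_succ, H_succ]
  field_simp
  ring

/-- The even extension of `h` to the integers. -/
noncomputable def hInt (m : ℤ) : ℝ := h m.natAbs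

lemma hInt_natCast (n : ℕ) : hInt n = h n := rfl

lemma hInt_neg (m : ℤ) : hInt (-m) = hInt m := by simp [hInt]

lemma hInt_nonneg (m : ℤ) : 0 ≤ hInt m := h_nonneg _

lemma hInt_succ (m : ℤ) : hInt (m + 1) = hInt m + 1 / (2 * (m : ℝ) + 1) := by
  rcases Int.eq_nat_or_neg m with ⟨n, rfl | rfl⟩
  · rw [show (n : ℤ) + 1 = ((n + 1 : ℕ) : ℤ) by push_cast; rfl, hInt_natCast, hInt_natCast, h_succ]
    push_cast
    rfl
  · cases n with
    | zero => simp [hInt, h]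
    | succ n =>
      have e : (-((n + 1 : ℕ) : ℤ) + 1) = -(n : ℤ) := by push_cast; ring
      rw [e, hInt_neg, hInt_neg, hInt_natCast, hInt_natCast, h_succ]
      push_cast
      have : 2 * (n : ℝ) + 1 ≠ 0 := by positivity
      rw [show 2 * (-((n : ℝ) + 1)) + 1 = -(2 * n + 1) by ring]
      field_simp
      ring

lemma h_mono : Monotone h :=
  monotone_nat_of_le_succ fun n => by
    rw [h_succ]; exact le_add_of_nonneg_right (by positivity)

lemma tendsto_one_div_two_mul_add (c : ℝ) :
    Tendsto (fun N : ℕ => 1 / (2 * (N : ℝ) + c)) atTop (𝓝 0) :=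
  tendsto_const_nhds.div_atTop (tendsto_atTop_add_const_right _ _
    (tendsto_natCast_atTop_atTop.const_mul_atTop (by norm_num)))

lemma tendsto_one_div_add (c : ℝ) : Tendsto (fun N : ℕ => 1 / ((N : ℝ) + c)) atTop (𝓝 0) :=
  tendsto_const_nhds.div_atTop (tendsto_atTop_add_const_right _ _ tendsto_natCast_atTop_atTop)

lemma tendsto_sum_odd_poles (k : ℕ) :
    Tendsto (fun N => ∑ n ∈ range N, (1 / (2 * ((n : ℝ) + 1) - (2 * k + 1))
      - 1 / (2 * ((n : ℝ) + 1) + (2 * k + 1)))) atTop (𝓝 (1 / (2 * (k : ℝ) + 1))) := by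
  induction k with
  | zero =>
    have := (tendsto_one_div_two_mul_add 1).const_sub 1
    rw [sub_zero] at this
    simp only [CharP.cast_eq_zero, mul_zero, zero_add, div_one]
    refine this.congr fun N => ?_
    have e : ∀ n ∈ range N, 1 / (2 * ((n : ℝ) + 1) - 1) - 1 / (2 * ((n : ℝ) + 1) + 1)
        = 1 / (2 * (n : ℝ) + 1) - 1 / (2 * ((n + 1 : ℕ) : ℝ) + 1) := by
      intro n _
      push_cast
      congr 2
      ring
    rw [sum_congr rfl e, sum_range_sub' fun n : ℕ => 1 / (2 * (n : ℝ) + 1)]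
    simp
  | succ k ih =>
    have h1 := (tendsto_one_div_two_mul_add (-(2 * k + 1))).sub_const (1 / (-(2 * (k : ℝ) + 1)))
    have h2 := (tendsto_one_div_two_mul_add (2 * k + 3)).const_sub (1 / (2 * (k : ℝ) + 3))
    have h3 := (ih.sub h1).add h2
    rw [show 1 / (2 * (k : ℝ) + 1) - (0 - 1 / (-(2 * (k : ℝ) + 1))) + (1 / (2 * (k : ℝ) + 3) - 0)
      = 1 / (2 * ((k + 1 : ℕ) : ℝ) + 1) by push_cast; rw [one_div_neg_eq_neg_one_div]; ring] at h3
    refine h3.congr fun N => ?_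
    have e1 := sum_range_sub (fun n : ℕ => 1 / (2 * (n : ℝ) + (-(2 * k + 1)))) N
    have e2 := sum_range_sub' (fun n : ℕ => 1 / (2 * (n : ℝ) + (2 * k + 3))) N
    simp only [CharP.cast_eq_zero, mul_zero, zero_add] at e1 e2
    rw [← e1, ← e2, ← sum_sub_distrib, ← sum_add_distrib]
    refine sum_congr rfl fun n _ => ?_
    push_cast
    rw [show 2 * ((n : ℝ) + 1) + -(2 * k + 1) = 2 * (n + 1) - (2 * k + 1) by ring,
      show 2 * (n : ℝ) + -(2 * k + 1) = 2 * (n + 1) - (2 * (k + 1) + 1) by ring,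
      show 2 * (n : ℝ) + (2 * k + 3) = 2 * (n + 1) + (2 * k + 1) by ring,
      show 2 * ((n : ℝ) + 1) + (2 * k + 3) = 2 * (n + 1) + (2 * (k + 1) + 1) by ring]
    ring

lemma odd_ne_even (n k : ℕ) : 2 * ((n : ℝ) + 1) - (2 * k + 1) ≠ 0 := by
  intro h0
  have : (2 * (n + 1) : ℤ) = 2 * k + 1 := by exact_mod_cast sub_eq_zero.1 h0
  omega

lemma hInt_add_succ (k n : ℕ) :
    hInt ((k + 1 : ℕ) + (n + 1)) = hInt (k + (n + 1)) + 1 / (2 * ((n : ℝ) + 1) + (2 * k + 1)) := by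
  have := hInt_succ (k + (n + 1))
  push_cast at this ⊢
  rw [show (k : ℤ) + 1 + (n + 1) = k + (n + 1) + 1 by ring, this]
  congr 2
  ring

lemma hInt_sub_succ (k n : ℕ) :
    hInt ((k + 1 : ℕ) - (n + 1)) = hInt (k - (n + 1)) - 1 / (2 * ((n : ℝ) + 1) - (2 * k + 1)) := by
  have := hInt_succ (k - (n + 1))
  push_cast at this ⊢
  rw [show (k : ℤ) + 1 - (n + 1) = k - (n + 1) + 1 by ring, this,
    show 2 * ((k : ℝ) - (n + 1)) + 1 = -(2 * (n + 1) - (2 * k + 1)) by ring,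
    one_div_neg_eq_neg_one_div]
  ring

lemma hInt_sub_le_add (k n : ℕ) : hInt (k - (n + 1)) ≤ hInt (k + (n + 1)) := h_mono (by omega)

lemma tendsto_hInt_sub_div (k : ℕ) :
    Tendsto (fun N => ∑ n ∈ range N, (hInt (k + (n + 1)) - hInt (k - (n + 1))) / ((n : ℝ) + 1))
      atTop (𝓝 (2 * oddHarm 2 k)) := by
  induction k with
  | zero =>
    have : ∀ n : ℕ, hInt ((0 : ℕ) - (n + 1)) = hInt ((0 : ℕ) + (n + 1)) := fun n => by
      rw [← hInt_neg]; congr 1; push_cast; ring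
    simp only [this, sub_self, zero_div, sum_const_zero]
    simp [oddHarm]
  | succ k ih =>
    have h1 := ih.add ((tendsto_sum_odd_poles k).const_mul (2 / (2 * (k : ℝ) + 1)))
    rw [show 2 * oddHarm 2 k + 2 / (2 * (k : ℝ) + 1) * (1 / (2 * k + 1)) = 2 * oddHarm 2 (k + 1) by
      rw [oddHarm_succ]; field_simp] at h1
    refine h1.congr fun N => ?_
    rw [mul_sum, ← sum_add_distrib]
    refine sum_congr rfl fun n _ => ?_
    rw [hInt_add_succ, hInt_sub_succ]
    have e1 := odd_ne_even n k
    have e2 : 2 * ((n : ℝ) + 1) + (2 * k + 1) ≠ 0 := by positivity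
    have e3 : 2 * (k : ℝ) + 1 ≠ 0 := by positivity
    have e4 : (n : ℝ) + 1 ≠ 0 := by positivity
    generalize 2 * (k : ℝ) + 1 = y at e1 e2 e3 ⊢
    generalize (n : ℝ) + 1 = x at e1 e2 e4 ⊢
    have hp := one_div_mul_cancel e1
    have hq := one_div_mul_cancel e2
    generalize 1 / (2 * x - y) = p at hp ⊢
    generalize 1 / (2 * x + y) = q at hq ⊢
    field_simp
    linear_combination hp - hq

lemma hasSum_hInt_add_div_sq (k : ℕ) :
    HasSum (fun n : ℕ => (hInt (k + (n + 1)) + hInt (k - (n + 1))) / ((n : ℝ) + 1) ^ 2)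
      (2 * zeta 2 * h k + 7 / 2 * zeta 3 - 4 * oddHarm 3 k) := by
  refine hasSum_of_tendsto (fun n => div_nonneg (add_nonneg (hInt_nonneg _) (hInt_nonneg _))
    (by positivity)) ?_
  induction k with
  | zero =>
    have e1 : ∀ n : ℕ, hInt ((0 : ℕ) - (n + 1)) = h (n + 1) := fun n => by
      rw [← hInt_neg, ← hInt_natCast]; congr 1
    have e2 : ∀ n : ℕ, hInt ((0 : ℕ) + (n + 1)) = h (n + 1) := fun n => by
      rw [← hInt_natCast]; congr 1; push_cast; ring
    refine ((hasSum_h_div_sq.mul_left 2).of_eq (fun n => ?_) ?_).tendsto_sum_nat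
    · rw [e1, e2, two_mul, add_div]
    · simp [oddHarm, h]; ring
  | succ k ih =>
    have h1 := ((tendsto_sum_odd_poles k).const_mul (2 / (2 * (k : ℝ) + 1))).sub
      (hasSum_zeta (le_refl 2)).tendsto_sum_nat
    have h2 := ih.sub (h1.const_mul (2 / (2 * (k : ℝ) + 1)))
    rw [show 2 * zeta 2 * h k + 7 / 2 * zeta 3 - 4 * oddHarm 3 k
      - 2 / (2 * (k : ℝ) + 1) * (2 / (2 * k + 1) * (1 / (2 * k + 1)) - zeta 2)
      = 2 * zeta 2 * h (k + 1) + 7 / 2 * zeta 3 - 4 * oddHarm 3 (k + 1) by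
      rw [oddHarm_succ, h_succ]; field_simp; ring] at h2
    refine h2.congr fun N => ?_
    rw [mul_sum, ← sum_sub_distrib, mul_sum, ← sum_sub_distrib]
    refine sum_congr rfl fun n _ => ?_
    rw [hInt_add_succ, hInt_sub_succ]
    have e1 := odd_ne_even n k
    have e2 : 2 * ((n : ℝ) + 1) + (2 * k + 1) ≠ 0 := by positivity
    have e3 : 2 * (k : ℝ) + 1 ≠ 0 := by positivity
    have e4 : (n : ℝ) + 1 ≠ 0 := by positivity
    generalize 2 * (k : ℝ) + 1 = y at e1 e2 e3 ⊢
    generalize (n : ℝ) + 1 = x at e1 e2 e4 ⊢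
    have hp := one_div_mul_cancel e1
    have hq := one_div_mul_cancel e2
    generalize 1 / (2 * x - y) = p at hp ⊢
    generalize 1 / (2 * x + y) = q at hq ⊢
    field_simp
    linear_combination (2 * x - y) * hq - (2 * x + y) * hp

lemma hasSum_hInt_sub_div_cube (k : ℕ) :
    HasSum (fun n : ℕ => (hInt (k + (n + 1)) - hInt (k - (n + 1))) / ((n : ℝ) + 1) ^ 3)
      (8 * oddHarm 4 k - 4 * zeta 2 * oddHarm 2 k) := by
  refine hasSum_of_tendsto (fun n => div_nonneg (sub_nonneg.2 (hInt_sub_le_add k n))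
    (by positivity)) ?_
  induction k with
  | zero =>
    have : ∀ n : ℕ, hInt ((0 : ℕ) - (n + 1)) = hInt ((0 : ℕ) + (n + 1)) := fun n => by
      rw [← hInt_neg]; congr 1; push_cast; ring
    simp only [this, sub_self, zero_div, sum_const_zero]
    simp [oddHarm]
  | succ k ih =>
    have h1 := ((tendsto_sum_odd_poles k).const_mul (2 / (2 * (k : ℝ) + 1))).sub
      (hasSum_zeta (le_refl 2)).tendsto_sum_nat
    have h2 := ih.add (h1.const_mul (4 / (2 * (k : ℝ) + 1) ^ 2))
    rw [show 8 * oddHarm 4 k - 4 * zeta 2 * oddHarm 2 k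
      + 4 / (2 * (k : ℝ) + 1) ^ 2 * (2 / (2 * k + 1) * (1 / (2 * k + 1)) - zeta 2)
      = 8 * oddHarm 4 (k + 1) - 4 * zeta 2 * oddHarm 2 (k + 1) by
      rw [oddHarm_succ, oddHarm_succ]; field_simp; ring] at h2
    refine h2.congr fun N => ?_
    rw [mul_sum, ← sum_sub_distrib, mul_sum, ← sum_add_distrib]
    refine sum_congr rfl fun n _ => ?_
    rw [hInt_add_succ, hInt_sub_succ]
    have e1 := odd_ne_even n k
    have e2 : 2 * ((n : ℝ) + 1) + (2 * k + 1) ≠ 0 := by positivity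
    have e3 : 2 * (k : ℝ) + 1 ≠ 0 := by positivity
    have e4 : (n : ℝ) + 1 ≠ 0 := by positivity
    generalize 2 * (k : ℝ) + 1 = y at e1 e2 e3 ⊢
    generalize (n : ℝ) + 1 = x at e1 e2 e4 ⊢
    have hp := one_div_mul_cancel e1
    have hq := one_div_mul_cancel e2
    generalize 1 / (2 * x - y) = p at hp ⊢
    generalize 1 / (2 * x + y) = q at hq ⊢
    field_simp
    linear_combination (4 * x ^ 2 + 2 * x * y + y ^ 2) * hp - (4 * x ^ 2 - 2 * x * y + y ^ 2) * hq

/-- Fold a double series with vanishing diagonal along its diagonals. -/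
lemma HasSum.fold_diagonals {g : ℕ × ℕ → ℝ} {s : ℝ} (hg : HasSum g s) (h0 : ∀ a, g (a, a) = 0) :
    HasSum (fun p : ℕ × ℕ => g (p.2, p.2 + p.1 + 1) + g (p.2 + p.1 + 1, p.2)) s := by
  set A : Set (ℕ × ℕ) := {p | p.1 < p.2}
  set B : Set (ℕ × ℕ) := {p | p.2 < p.1}
  have hA := (hg.summable.indicator A).hasSum
  have hB := (hg.summable.indicator B).hasSum
  have hAB : ∀ p, A.indicator g p + B.indicator g p = g p := by
    rintro ⟨a, b⟩
    rcases lt_trichotomy a b with hab | rfl | hab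
    · simp [A, B, Set.indicator, hab, hab.le]
    · simp [A, B, Set.indicator, h0]
    · simp [A, B, Set.indicator, hab, hab.le]
  have hs : ∑' p, A.indicator g p + ∑' p, B.indicator g p = s :=
    (hA.add hB).unique (by simpa only [hAB] using hg)
  have iA : Function.Injective fun p : ℕ × ℕ => (p.2, p.2 + p.1 + 1) := by
    rintro ⟨a, b⟩ ⟨c, d⟩ hp
    simp only [Prod.mk.injEq] at hp ⊢
    omega
  have iB : Function.Injective fun p : ℕ × ℕ => (p.2 + p.1 + 1, p.2) := by
    rintro ⟨a, b⟩ ⟨c, d⟩ hp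
    simp only [Prod.mk.injEq] at hp ⊢
    omega
  have jA := (iA.hasSum_iff (f := A.indicator g) (a := ∑' p, A.indicator g p) ?_).2 hA
  · have jB := (iB.hasSum_iff (f := B.indicator g) (a := ∑' p, B.indicator g p) ?_).2 hB
    · have := jA.add jB
      rw [hs] at this
      convert this using 1
      ext ⟨n, a⟩
      have e1 : a < a + n + 1 := by omega
      simp [A, B, Set.indicator, e1]
    · rintro ⟨a, b⟩ hp
      refine Set.indicator_of_notMem (fun hb => hp ⟨(a - b - 1, b), ?_⟩) _
      have : b < a := hb
      ext <;> (simp; try omega)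
  · rintro ⟨a, b⟩ hp
    refine Set.indicator_of_notMem (fun hb => hp ⟨(b - a - 1, a), ?_⟩) _
    have : a < b := hb
    ext <;> (simp; try omega)

lemma hasSum_zeta_tail {s : ℕ} (hs : 2 ≤ s) (N : ℕ) :
    HasSum (fun n : ℕ => (1 : ℝ) / ((n : ℝ) + N + 1) ^ s) (zeta s - harm s N) :=
  ((hasSum_nat_add_iff' N).2 (hasSum_zeta hs)).of_eq (fun n => by push_cast; rfl) rfl

/-- A double series with nonnegative terms is summable once an iterated sum is. -/
lemma hasSum_prod_of_nonneg {f : ℕ × ℕ → ℝ} (hf : ∀ p, 0 ≤ f p) {a : ℕ → ℝ} {s : ℝ}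
    (ha : ∀ i, HasSum (fun j => f (i, j)) (a i)) (hs : HasSum a s) : HasSum f s := by
  have h1 : Summable f := by
    rw [summable_prod_of_nonneg hf]
    exact ⟨fun i => (ha i).summable, by simpa only [(ha _).tsum_eq] using hs.summable⟩
  rw [← (h1.hasSum.prod_fiberwise ha).unique hs]
  exact h1.hasSum

lemma hasSum_hInt_sub_double :
    HasSum (fun p : ℕ × ℕ => hInt ((p.1 + 1 : ℕ) - (p.2 + 1))
        / (((p.2 : ℝ) + 1) ^ 2 * ((p.1 : ℝ) + 1) ^ 3))
      (zeta 2 * oddEulerSum 1 3 + 7 / 4 * zeta 3 ^ 2 - 2 * oddEulerSum 3 3 - 4 * oddEulerSum 4 2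
        + 2 * zeta 2 * oddEulerSum 2 2) := by
  have h1 : HasSum (fun p : ℕ × ℕ => (hInt ((p.1 + 1 : ℕ) + (p.2 + 1))
      + hInt ((p.1 + 1 : ℕ) - (p.2 + 1))) / ((p.2 : ℝ) + 1) ^ 2 / ((p.1 : ℝ) + 1) ^ 3)
      (2 * zeta 2 * oddEulerSum 1 3 + 7 / 2 * zeta 3 * zeta 3 - 4 * oddEulerSum 3 3) := by
    refine hasSum_prod_of_nonneg (a := fun i => (2 * zeta 2 * h (i + 1) + 7 / 2 * zeta 3
        - 4 * oddHarm 3 (i + 1)) / ((i : ℝ) + 1) ^ 3) (fun p => ?_)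
      (fun i => (hasSum_hInt_add_div_sq (i + 1)).div_const _) ?_
    · exact div_nonneg (div_nonneg (add_nonneg (hInt_nonneg _) (hInt_nonneg _)) (by positivity))
        (by positivity)
    refine ((((hasSum_h_div (q := 3) (by norm_num)).mul_left (2 * zeta 2)).add
      ((hasSum_zeta (s := 3) (by norm_num)).mul_left (7 / 2 * zeta 3))).sub
      ((hasSum_oddEulerSum (a := 3) (q := 3) (by norm_num) (by norm_num)).mul_left 4)).of_eq
      (fun n => by ring) rfl
  have h2 : HasSum (fun p : ℕ × ℕ => (hInt ((p.1 + 1 : ℕ) + (p.2 + 1))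
      - hInt ((p.1 + 1 : ℕ) - (p.2 + 1))) / ((p.2 : ℝ) + 1) ^ 3 / ((p.1 : ℝ) + 1) ^ 2)
      (8 * oddEulerSum 4 2 - 4 * zeta 2 * oddEulerSum 2 2) := by
    refine hasSum_prod_of_nonneg (a := fun i => (8 * oddHarm 4 (i + 1)
        - 4 * zeta 2 * oddHarm 2 (i + 1)) / ((i : ℝ) + 1) ^ 2) (fun p => ?_)
      (fun i => (hasSum_hInt_sub_div_cube (i + 1)).div_const (((i : ℝ) + 1) ^ 2)) ?_
    · exact div_nonneg (div_nonneg (sub_nonneg.2 (hInt_sub_le_add (p.1 + 1) p.2)) (by positivity))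
        (by positivity)
    refine (((hasSum_oddEulerSum (a := 4) (q := 2) (by norm_num) (by norm_num)).mul_left 8).sub
      ((hasSum_oddEulerSum (a := 2) (q := 2) (by norm_num) (by norm_num)).mul_left
        (4 * zeta 2))).of_eq (fun n => by ring) rfl
  have h3 := (h1.sub ((Equiv.prodComm ℕ ℕ).hasSum_iff.2 h2)).div_const 2
  refine h3.of_eq ?_ (by ring)
  · rintro ⟨a, b⟩
    have e1 : hInt ((b + 1 : ℕ) + (a + 1)) = hInt ((a + 1 : ℕ) + (b + 1)) := by
      congr 1; push_cast; ring
    have e2 : hInt ((b + 1 : ℕ) - (a + 1)) = hInt ((a + 1 : ℕ) - (b + 1)) := by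
      rw [← hInt_neg]; congr 1; push_cast; ring
    simp only [Function.comp, Equiv.prodComm_apply, Prod.swap_prod_mk, e1, e2]
    field_simp
    ring

/-- The value of the mixed tail sum that follows from the even extension of `h`. -/
lemma hasSum_h_mul_tails' :
    HasSum (fun n : ℕ => h (n + 1) * ((zeta 3 - H3 (n + 1)) / ((n : ℝ) + 1) ^ 2
        + (zeta 2 - H2 (n + 1)) / ((n : ℝ) + 1) ^ 3))
      (2 * zeta 2 * (oddEulerSum 1 3 + oddEulerSum 2 2) - 2 * oddEulerSum 3 3
        - 4 * oddEulerSum 4 2) := by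
  have h1 := hasSum_hInt_sub_double.fold_diagonals (fun a => by simp [hInt, h])
  have h2 := h1.prod_fiberwise (g := fun n : ℕ => h (n + 1)
    * ((zeta 3 + (zeta 3 - H3 (n + 1))) / ((n : ℝ) + 1) ^ 2
      - (zeta 2 - (zeta 2 - H2 (n + 1))) / ((n : ℝ) + 1) ^ 3)) fun n => ?_
  · refine ((h2.sub (hasSum_h_div_sq.mul_left (zeta 3))).add
      ((hasSum_h_div (q := 3) (by norm_num)).mul_left (zeta 2))).of_eq (fun n => by ring) (by ring)
  · have t2 := hasSum_zeta_tail (le_refl 2) (n + 1)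
    have t3 := hasSum_zeta_tail (s := 3) (by norm_num) (n + 1)
    have z2 := hasSum_zeta (le_refl 2)
    have z3 := hasSum_zeta (s := 3) (by norm_num)
    refine ((((z3.add t3).div_const (((n : ℝ) + 1) ^ 2)).sub
      ((z2.sub t2).div_const (((n : ℝ) + 1) ^ 3))).mul_left (h (n + 1))).of_eq (fun a => ?_) rfl
    have e1 : hInt ((a + 1 : ℕ) - ((a + n + 1 : ℕ) + 1)) = h (n + 1) := by
      rw [← hInt_neg, ← hInt_natCast]; congr 1; push_cast; ring
    have e2 : hInt ((a + n + 1 + 1 : ℕ) - ((a : ℕ) + 1)) = h (n + 1) := by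
      rw [← hInt_natCast]; congr 1; push_cast; ring
    simp only [e1, e2]
    push_cast
    have p1 : (a : ℝ) + n + 1 + 1 ≠ 0 := by positivity
    have p2 : (a : ℝ) + (n + 1) + 1 ≠ 0 := by positivity
    field_simp
    ring

/-- The difference of the simple poles at `k` and `-k`, with value `-1 / (2 * k)` at `m = k`. -/
noncomputable def poleDiff (m k : ℕ) : ℝ := 1 / ((m : ℝ) - k) - 1 / ((m : ℝ) + k)

lemma h_le_H (n : ℕ) : h n ≤ H n :=
  sum_le_sum fun j _ => one_div_le_one_div_of_le (by positivity)
    (by linarith [(j.cast_nonneg : (0 : ℝ) ≤ j)])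

lemma tendsto_h_div_sub (c : ℝ) : Tendsto (fun n : ℕ => h n / ((n : ℝ) - c)) atTop (𝓝 0) := by
  have h0 : Tendsto (fun n : ℕ => h n / (n : ℝ)) atTop (𝓝 0) :=
    squeeze_zero (fun n => div_nonneg (h_nonneg n) n.cast_nonneg)
      (fun n => div_le_div_of_nonneg_right (h_le_H n) n.cast_nonneg) tendsto_H_div
  have h1 := h0.mul (((tendsto_one_div_add (-c)).const_mul c).const_add 1)
  simp only [zero_mul] at h1
  refine h1.congr' ?_
  filter_upwards [eventually_gt_atTop 0, tendsto_natCast_atTop_atTop.eventually_gt_atTop c]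
    with n hn hc
  have e1 : (n : ℝ) ≠ 0 := by positivity
  have e2 : (n : ℝ) - c ≠ 0 := (sub_pos.2 hc).ne'
  rw [← sub_eq_add_neg]
  field_simp
  ring

lemma sum_hInt_sub_div (k N : ℕ) :
    ∑ j ∈ range (N + k), (hInt (k + (j + 1)) - hInt (k - (j + 1))) / ((j : ℝ) + 1)
      = ∑ m ∈ range N, h (m + 1) * poleDiff (m + 1) k
        + ∑ i ∈ range (2 * k), h (i + 1 + N) / (((i + 1 + N : ℕ) : ℝ) - k) := by
  induction N with
  | zero =>
    have e1 : ∀ j ∈ range k, hInt (k + (j + 1)) / ((j : ℝ) + 1)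
        = h (k + j + 1) / (((k + j + 1 : ℕ) : ℝ) - k) := by
      intro j _
      rw [show (k : ℤ) + (j + 1) = ((k + j + 1 : ℕ) : ℤ) by push_cast; ring, hInt_natCast]
      congr 1
      push_cast
      ring
    have e2 : ∑ j ∈ range k, -(hInt (k - (j + 1)) / ((j : ℝ) + 1))
        = ∑ i ∈ range k, h i / ((i : ℝ) - k) := by
      rw [← sum_range_reflect]
      refine sum_congr rfl fun i hi => ?_
      have hi := mem_range.1 hi
      obtain ⟨d, rfl⟩ := Nat.exists_eq_add_of_lt hi
      rw [show i + d + 1 - 1 - i = d by omega,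
        show ((i + d + 1 : ℕ) : ℤ) - (d + 1) = (i : ℤ) by push_cast; ring, hInt_natCast, ← div_neg]
      congr 1
      push_cast
      ring
    have e3 : ∑ i ∈ range k, h i / ((i : ℝ) - k)
        = ∑ i ∈ range k, h (i + 1) / (((i + 1 : ℕ) : ℝ) - k) := by
      have := sum_range_succ (fun i : ℕ => h i / ((i : ℝ) - k)) k
      rw [sum_range_succ'] at this
      simpa [h] using this.symm
    have e4 : ∀ j ∈ range k, (hInt (k + (j + 1)) - hInt (k - (j + 1))) / ((j : ℝ) + 1)
        = h (k + j + 1) / (((k + j + 1 : ℕ) : ℝ) - k)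
          + -(hInt (k - (j + 1)) / ((j : ℝ) + 1)) := fun j hj => by
      rw [← e1 j hj]; ring
    simp only [zero_add, range_zero, sum_empty, add_zero]
    rw [sum_congr rfl e4, sum_add_distrib, e2, e3, two_mul, sum_range_add, add_comm]
  | succ N ih =>
    have e := sum_range_succ (fun i : ℕ => h (i + 1 + N) / (((i + 1 + N : ℕ) : ℝ) - k)) (2 * k)
    rw [sum_range_succ'] at e
    have e' : ∑ i ∈ range (2 * k), h (i + 1 + (N + 1)) / (((i + 1 + (N + 1) : ℕ) : ℝ) - k)
        = ∑ i ∈ range (2 * k), h (i + 1 + 1 + N) / (((i + 1 + 1 + N : ℕ) : ℝ) - k) :=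
      sum_congr rfl fun i _ => by rw [show i + 1 + (N + 1) = i + 1 + 1 + N by ring]
    rw [show N + 1 + k = N + k + 1 by ring, sum_range_succ, ih, sum_range_succ, e',
      eq_sub_of_add_eq e,
      show (k : ℤ) + ((N + k : ℕ) + 1) = ((2 * k + 1 + N : ℕ) : ℤ) by push_cast; ring,
      show (k : ℤ) - ((N + k : ℕ) + 1) = -((N + 1 : ℕ) : ℤ) by push_cast; ring, hInt_neg,
      hInt_natCast, hInt_natCast, show 0 + 1 + N = N + 1 by ring, poleDiff]
    push_cast
    rw [show 2 * (k : ℝ) + 1 + N - k = N + k + 1 by ring,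
      show (N : ℝ) + 1 + k = N + k + 1 by ring]
    ring

lemma tendsto_sum_h_mul_poleDiff (k : ℕ) :
    Tendsto (fun N => ∑ m ∈ range N, h (m + 1) * poleDiff (m + 1) k) atTop
      (𝓝 (2 * oddHarm 2 k)) := by
  have h1 := (tendsto_add_atTop_iff_nat k).2 (tendsto_hInt_sub_div k)
  have h2 : Tendsto (fun N : ℕ => ∑ i ∈ range (2 * k),
      h (i + 1 + N) / (((i + 1 + N : ℕ) : ℝ) - k)) atTop (𝓝 (∑ i ∈ range (2 * k), 0)) :=
    tendsto_finsetSum _ fun i _ => by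
      refine ((tendsto_add_atTop_iff_nat (i + 1)).2 (tendsto_h_div_sub k)).congr fun N => ?_
      rw [add_comm]
  have h3 := h1.sub h2
  rw [sum_const_zero, sub_zero] at h3
  exact h3.congr fun N => by rw [sum_hInt_sub_div, add_sub_cancel_right]

lemma tendsto_sum_poleDiff (m : ℕ) :
    Tendsto (fun N => ∑ k ∈ range N, (2 / ((k : ℝ) + 1) + poleDiff m (k + 1))) atTop
      (𝓝 (H m + H (m - 1))) := by
  induction m with
  | zero =>
    have : ∀ k : ℕ, 2 / ((k : ℝ) + 1) + poleDiff 0 (k + 1) = 0 := fun k => by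
      have : (k : ℝ) + 1 ≠ 0 := by positivity
      simp only [poleDiff]
      push_cast
      rw [zero_sub, one_div_neg_eq_neg_one_div]
      ring
    simp [this, H]
  | succ m ih =>
    have h1 := (tendsto_one_div_add (-(m : ℝ))).sub_const (1 / (-(m : ℝ)))
    have h2 := (tendsto_one_div_add ((m : ℝ) + 1)).const_sub (1 / ((m : ℝ) + 1))
    have h3 := (ih.add h1).add h2
    rw [show H m + H (m - 1) + (0 - 1 / (-(m : ℝ))) + (1 / ((m : ℝ) + 1) - 0)
      = H (m + 1) + H (m + 1 - 1) by
        rw [one_div_neg_eq_neg_one_div, add_tsub_cancel_right, H_succ, H_eq_pred m]; ring] at h3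
    refine h3.congr fun N => ?_
    have e1 := sum_range_sub (fun n : ℕ => 1 / ((n : ℝ) + -(m : ℝ))) N
    have e2 := sum_range_sub' (fun n : ℕ => 1 / ((n : ℝ) + ((m : ℝ) + 1))) N
    simp only [CharP.cast_eq_zero, zero_add] at e1 e2
    rw [← e1, ← e2, ← sum_add_distrib, ← sum_add_distrib]
    refine sum_congr rfl fun k _ => ?_
    simp only [poleDiff]
    push_cast
    rw [show (m : ℝ) - (k + 1) = -((k : ℝ) + 1 + -m) by ring,
      show (m : ℝ) + 1 - (k + 1) = -((k : ℝ) + -m) by ring,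
      show (m : ℝ) + (k + 1) = (k : ℝ) + (m + 1) by ring,
      show (m : ℝ) + 1 + (k + 1) = (k : ℝ) + 1 + (m + 1) by ring,
      one_div_neg_eq_neg_one_div, one_div_neg_eq_neg_one_div]
    ring

lemma poleDiff_self (m : ℕ) : poleDiff m m = -(1 / (2 * (m : ℝ))) := by
  rw [poleDiff, sub_self, div_zero, zero_sub, two_mul]

lemma poleDiff_div_pow_four (m k : ℕ) :
    poleDiff (m + 1) (k + 1) / ((k : ℝ) + 1) ^ 4
      = 2 / ((m : ℝ) + 1) ^ 2 * (1 / ((k : ℝ) + 1) ^ 3)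
        + 1 / ((m : ℝ) + 1) ^ 4 * (2 / ((k : ℝ) + 1) + poleDiff (m + 1) (k + 1))
        - if k = m then 4 / ((m : ℝ) + 1) ^ 5 else 0 := by
  have hm : (m : ℝ) + 1 ≠ 0 := by positivity
  have hk : (k : ℝ) + 1 ≠ 0 := by positivity
  split_ifs with hkm
  · subst hkm
    rw [poleDiff_self]
    push_cast
    field_simp
    norm_num
  · have e1 : ((m : ℝ) + 1) - (k + 1) ≠ 0 := by
      rw [add_sub_add_right_eq_sub, sub_ne_zero]
      exact_mod_cast Ne.symm hkm
    have e2 : ((m : ℝ) + 1) + (k + 1) ≠ 0 := by positivity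
    simp only [poleDiff]
    push_cast
    generalize (m : ℝ) + 1 = x at hm e1 e2 ⊢
    generalize (k : ℝ) + 1 = y at hk e1 e2 ⊢
    have hp := one_div_mul_cancel e1
    have hq := one_div_mul_cancel e2
    generalize 1 / (x - y) = p at hp ⊢
    generalize 1 / (x + y) = q at hq ⊢
    field_simp
    linear_combination (x + y) * (x ^ 2 + y ^ 2) * hp - (x - y) * (x ^ 2 + y ^ 2) * hq

lemma abs_poleDiff_le (m k : ℕ) :
    |poleDiff (m + 1) (k + 1)| ≤ 4 * ((k : ℝ) + 1) ^ 2 / ((m : ℝ) + 1) ^ 2 := by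
  have hm : (1 : ℝ) ≤ (m : ℝ) + 1 := by linarith [(m.cast_nonneg : (0 : ℝ) ≤ m)]
  have hk : (1 : ℝ) ≤ (k : ℝ) + 1 := by linarith [(k.cast_nonneg : (0 : ℝ) ≤ k)]
  rcases lt_trichotomy m k with hmk | rfl | hmk
  · have h1 : (m : ℝ) + 1 + 1 ≤ k + 1 := by exact_mod_cast Nat.succ_le_succ hmk
    simp only [poleDiff]
    push_cast
    generalize (m : ℝ) + 1 = x at hm h1 ⊢
    generalize (k : ℝ) + 1 = y at hk h1 ⊢
    have e1 : 0 < y - x := by linarith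
    have e2 : 0 < x + y := by linarith
    rw [show 1 / (x - y) - 1 / (x + y) = -(2 * y / ((y - x) * (x + y))) by
      rw [← neg_sub y x, one_div_neg_eq_neg_one_div]; field_simp; ring, abs_neg,
      abs_of_nonneg (by positivity), div_le_div_iff₀ (by positivity) (by positivity)]
    have : x ^ 2 ≤ (y - x) * (x + y) * (2 * y) := by
      have h2 : x + y ≤ (y - x) * (x + y) := le_mul_of_one_le_left e2.le (by linarith)
      nlinarith [mul_le_mul_of_nonneg_right h2 (by linarith : 0 ≤ 2 * y)]
    nlinarith
  · rw [poleDiff_self, abs_neg, abs_of_nonneg (by positivity), mul_div_assoc, div_self (by positivity)]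
    push_cast
    rw [div_le_iff₀ (by positivity)]
    linarith
  · have h1 : (k : ℝ) + 1 + 1 ≤ m + 1 := by exact_mod_cast Nat.succ_le_succ hmk
    simp only [poleDiff]
    push_cast
    generalize (m : ℝ) + 1 = x at hm h1 ⊢
    generalize (k : ℝ) + 1 = y at hk h1 ⊢
    have e1 : 0 < x - y := by linarith
    have e2 : 0 < x + y := by linarith
    rw [show 1 / (x - y) - 1 / (x + y) = 2 * y / ((x - y) * (x + y)) by
      field_simp; ring,
      abs_of_nonneg (by positivity), div_le_div_iff₀ (by positivity) (by positivity)]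
    have : x ^ 2 ≤ (x - y) * (x + y) * (2 * y) := by
      have h2 : (y + 1) ^ 2 ≤ x ^ 2 := pow_le_pow_left₀ (by linarith) h1 2
      nlinarith [mul_le_mul_of_nonneg_left h2 (by linarith : 0 ≤ 2 * y - 1)]
    nlinarith

lemma summable_h_mul_poleDiff :
    Summable fun p : ℕ × ℕ => h (p.2 + 1) * poleDiff (p.2 + 1) (p.1 + 1) / ((p.1 : ℝ) + 1) ^ 4 := by
  refine Summable.of_norm_bounded (g := fun p : ℕ × ℕ => 4 * (1 / ((p.1 : ℝ) + 1) ^ 2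
    * (h (p.2 + 1) / ((p.2 : ℝ) + 1) ^ 2))) (((hasSum_zeta (le_refl 2)).summable.mul_of_nonneg
      hasSum_h_div_sq.summable (fun n => by positivity)
      (fun n => div_nonneg (h_nonneg _) (by positivity))).mul_left 4) ?_
  rintro ⟨k, m⟩
  have hk : (0 : ℝ) < (k : ℝ) + 1 := by positivity
  rw [Real.norm_eq_abs, abs_div, abs_mul, abs_of_nonneg (h_nonneg _),
    abs_of_pos (by positivity : (0 : ℝ) < ((k : ℝ) + 1) ^ 4), div_le_iff₀ (by positivity)]
  refine (mul_le_mul_of_nonneg_left (abs_poleDiff_le m k) (h_nonneg _)).trans_eq ?_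
  field_simp

/-- The quadratic sum `∑ H n * h n / n ^ 4` in terms of linear ones. -/
lemma hasSum_H_mul_h_div_pow_four :
    HasSum (fun n : ℕ => H (n + 1) * h (n + 1) / ((n : ℝ) + 1) ^ 4)
      (5 / 2 * oddEulerSum 1 5 + oddEulerSum 2 4 - 7 / 4 * zeta 3 ^ 2) := by
  have hD : Summable fun n : ℕ => H (n + 1) * h (n + 1) / ((n : ℝ) + 1) ^ 4 := by
    refine Summable.of_nonneg_of_le (fun n => div_nonneg (mul_nonneg (H_nonneg _) (h_nonneg _))
      (by positivity)) (fun n => ?_) hasSum_H_mul_h.summable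
    exact div_le_div_of_nonneg_left (mul_nonneg (H_nonneg _) (h_nonneg _)) (by positivity)
      (pow_le_pow_right₀ (by linarith [(n.cast_nonneg : (0 : ℝ) ≤ n)]) (by norm_num))
  have hrow : ∀ k : ℕ, HasSum
      (fun m : ℕ => h (m + 1) * poleDiff (m + 1) (k + 1) / ((k : ℝ) + 1) ^ 4)
      (2 * oddHarm 2 (k + 1) / ((k : ℝ) + 1) ^ 4) := fun k => by
    have hs := (summable_h_mul_poleDiff.prod_factor k).hasSum
    rwa [tendsto_nhds_unique hs.tendsto_sum_nat
      (((tendsto_sum_h_mul_poleDiff (k + 1)).div_const (((k : ℝ) + 1) ^ 4)).congr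
        fun N => by rw [sum_div])] at hs
  have hcol : ∀ m : ℕ, HasSum
      (fun k : ℕ => h (m + 1) * poleDiff (m + 1) (k + 1) / ((k : ℝ) + 1) ^ 4)
      (h (m + 1) * (2 / ((m : ℝ) + 1) ^ 2 * zeta 3
        + 1 / ((m : ℝ) + 1) ^ 4 * (H (m + 1) + H m) - 4 / ((m : ℝ) + 1) ^ 5)) := fun m => by
    have hs := (((Equiv.prodComm ℕ ℕ).summable_iff.2 summable_h_mul_poleDiff).prod_factor m).hasSum
    simp only [Function.comp, Equiv.prodComm_apply, Prod.swap_prod_mk] at hs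
    have ht := ((((hasSum_zeta (s := 3) (by norm_num)).tendsto_sum_nat.const_mul
      (2 / ((m : ℝ) + 1) ^ 2)).add ((tendsto_sum_poleDiff (m + 1)).const_mul
      (1 / ((m : ℝ) + 1) ^ 4))).sub
      (hasSum_ite_eq m (4 / ((m : ℝ) + 1) ^ 5)).tendsto_sum_nat).const_mul (h (m + 1))
    rwa [tendsto_nhds_unique hs.tendsto_sum_nat (ht.congr fun N => ?_)] at hs
    rw [mul_sum, mul_sum, ← sum_add_distrib, ← sum_sub_distrib, mul_sum]
    exact sum_congr rfl fun k _ => by rw [mul_div_assoc, poleDiff_div_pow_four]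
  have hb : HasSum (fun m : ℕ => h (m + 1) * (2 / ((m : ℝ) + 1) ^ 2 * zeta 3
        + 1 / ((m : ℝ) + 1) ^ 4 * (H (m + 1) + H m) - 4 / ((m : ℝ) + 1) ^ 5))
      (2 * zeta 3 * (7 / 4 * zeta 3) + 2 * ∑' n : ℕ, H (n + 1) * h (n + 1) / ((n : ℝ) + 1) ^ 4
        - 5 * oddEulerSum 1 5) := by
    refine (((hasSum_h_div_sq.mul_left (2 * zeta 3)).add (hD.hasSum.mul_left 2)).sub
      ((hasSum_h_div (q := 5) (by norm_num)).mul_left 5)).of_eq (fun n => ?_) rfl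
    rw [H_succ]
    field_simp
    ring
  have ha := hasSum_comm_of_summable
    (f := fun k m => h (m + 1) * poleDiff (m + 1) (k + 1) / ((k : ℝ) + 1) ^ 4)
    summable_h_mul_poleDiff hrow hcol hb
  have ha' := (hasSum_oddEulerSum (a := 2) (q := 4) (by norm_num) (by norm_num)).mul_left 2
  have := ha.unique (ha'.of_eq (fun n => by ring) rfl)
  exact hD.hasSum.of_eq (fun _ => rfl) (by linear_combination this / 2)

theorem stmt17 :
    Summable (fun k : ℕ => h (k + 1) / ((k : ℝ) + 1) ^ 3) ∧
    Summable (fun k : ℕ => h (k + 1) / ((k : ℝ) + 1) ^ 5) ∧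
    HasSum (fun k : ℕ => H (k + 1) * H2 (k + 1) * h (k + 1) / ((k : ℝ) + 1) ^ 2)
      ((45 / 8) * zeta 6 - (49 / 32) * (zeta 3) ^ 2
        + (1 / 2) * zeta 2 * (∑' k : ℕ, h (k + 1) / ((k : ℝ) + 1) ^ 3)
        + (3 / 8) * (∑' k : ℕ, h (k + 1) / ((k : ℝ) + 1) ^ 5)) := by
  have s3 := hasSum_h_div (q := 3) (by norm_num)
  have s5 := hasSum_h_div (q := 5) (by norm_num)
  refine ⟨s3.summable, s5.summable, ?_⟩
  rw [s3.tsum_eq, s5.tsum_eq]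
  have z22 : zeta 2 * zeta 2 = 5 / 2 * zeta 4 := by rw [zeta_two, zeta_four]; ring
  have z24 : zeta 2 * zeta 4 = 7 / 4 * zeta 6 := by rw [zeta_two, zeta_four, zeta_six]; ring
  have V := hasSum_h_mul_tails.unique hasSum_h_mul_tails'
  refine (((hasSum_H_mul_h.mul_left (zeta 2)).sub hasSum_zeta_sub_H2_mul_H_mul_h).add
    hasSum_H_mul_h_div_pow_four).of_eq (fun n => ?_) ?_
  · rw [H2_succ]
    field_simp
    ring
  · have o22 := odd_shuffle_two_two
    have o33 := odd_shuffle_three_three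
    have o24 := odd_shuffle_two_four
    linear_combination -4 / 7 * V + 16 / 7 * o24 - 3 / 7 * o33 - 8 / 7 * zeta 2 * o22
      - 9 / 7 * zeta 2 * z22 + 675 / 112 * z24
end
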